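/- arXiv:2301.13675 — 6 statements merged into one kernel-verified Lean document; each statement's English description precedes it below -/
import Mathlib

section
/- Let V be a valuation domain and M a V-module with pd M ≤ 1. Then every finitely generated submodule N of M is finitely presented and tight in M. Moreover, if M itself is finitely generated (hence finitely presented), then the tight submodules of M are exactly its finitely generated submodules. -/
universe u v

open Pointwise

def PdLeOne (V : Type u) [CommRing V] (M : Type v) [AddCommGroup M] [Module V M] : Prop :=
  ∃ (P : Type (max u v)) (_ : AddCommGroup P) (_ : Module V P) (f : P →ₗ[V] M),
    Module.Projective V P ∧ Function.Surjective f ∧ Module.Projective V (LinearMap.ker f)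

def Tight (V : Type u) [CommRing V] {M : Type v} [AddCommGroup M] [Module V M]
    (N : Submodule V M) : Prop :=
  PdLeOne V (M ⧸ N)

/-- `B` tight in `A`, for submodules `B ≤ A` of an ambient module. -/
def TightIn (V : Type u) [CommRing V] {M : Type v} [AddCommGroup M] [Module V M]
    (B A : Submodule V M) : Prop :=
  Tight V (Submodule.comap A.subtype B)

/-- A linear map from a module of finite rank to a free module has its image in finitely many
coordinates. -/
theorem exists_finset_forall_mem_supported {V : Type*} [CommRing V] [IsDomain V] {H ι : Type*}
    [AddCommGroup H] [Module V H] (hH : Module.rank V H < Cardinal.aleph0)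
    (s : H →ₗ[V] ι →₀ V) :
    ∃ S : Finset ι, ∀ h, s h ∈ Finsupp.supported V V (S : Set ι) := by
  classical
  obtain ⟨B, hB, hmax⟩ := exists_maximal_linearIndepOn V (id : H → H)
  have hfin : B.Finite :=
    Cardinal.lt_aleph0_iff_set_finite.mp ((LinearIndependent.cardinal_le_rank hB).trans_lt hH)
  let S : Finset ι := hfin.toFinset.biUnion fun b => (s b).support
  have hspan : Submodule.span V (id '' B) ≤ (Finsupp.supported V V (S : Set ι)).comap s := by
    rw [Submodule.span_le]
    rintro _ ⟨b, hb, rfl⟩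
    intro i hi
    simp only [S, Finset.coe_biUnion, Set.mem_iUnion]
    exact ⟨b, by simpa using hb, hi⟩
  refine ⟨S, fun h => ?_⟩
  by_cases hb : h ∈ B
  · exact hspan (Submodule.subset_span ⟨h, hb, rfl⟩)
  · obtain ⟨a, ha, hmem⟩ := hmax h hb
    have key := hspan hmem
    rw [Submodule.mem_comap, Finsupp.mem_supported'] at key
    rw [Finsupp.mem_supported']
    intro i hi
    simpa [ha] using key i hi

/-- Finitely generated torsion-free modules over a valuation domain are projective. -/
theorem projective_of_finite_of_isTorsionFree {V : Type*} [CommRing V] [IsDomain V]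
    [ValuationRing V] {T : Type*} [AddCommGroup T] [Module V T] [Module.Finite V T]
    [Module.IsTorsionFree V T] : Module.Projective V T := by
  have : Module.Flat V T := by
    rwa [Module.Flat.flat_iff_torsion_eq_bot_of_isBezout,
      ← Submodule.isTorsionFree_iff_torsion_eq_bot]
  have : Module.Free V T := Module.free_of_flat_of_isLocalRing
  infer_instance

/-- Over a valuation domain, a pure submodule of finite rank in a projective module is a finitely
generated direct summand. -/
theorem finite_ker_and_exists_retraction {V : Type*} [CommRing V] [IsDomain V]
    [ValuationRing V] {E T : Type*} [AddCommGroup E] [Module V E] [AddCommGroup T] [Module V T]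
    [Module.Projective V E] [Module.IsTorsionFree V T] (g : E →ₗ[V] T)
    (hg : Module.rank V (LinearMap.ker g) < Cardinal.aleph0) :
    Module.Finite V (LinearMap.ker g) ∧
      ∃ r : E →ₗ[V] LinearMap.ker g, r ∘ₗ (LinearMap.ker g).subtype = LinearMap.id := by
  classical
  obtain ⟨s, hs⟩ := ‹Module.Projective V E›.out
  set p : (E →₀ V) →ₗ[V] E := Finsupp.linearCombination V id
  obtain ⟨S, hS⟩ := exists_finset_forall_mem_supported hg (s ∘ₗ (LinearMap.ker g).subtype)
  let L := Finsupp.supported V V (S : Set E)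
  have : Module.Finite V L :=
    Module.Finite.equiv (Finsupp.supportedEquivFinsupp (M := V) (R := V) (S : Set E)).symm
  let u : L →ₗ[V] T × (E →₀ V) :=
    ((g ∘ₗ p).prod (LinearMap.id - s ∘ₗ p)) ∘ₗ L.subtype
  have : Module.Projective V (LinearMap.range u) :=
    projective_of_finite_of_isTorsionFree (V := V) (T := LinearMap.range u)
  obtain ⟨i, hi⟩ := u.rangeRestrict.exists_rightInverse_of_surjective u.range_rangeRestrict
  have hui (x : LinearMap.range u) : u (i x) = x :=
    congrArg Subtype.val (LinearMap.congr_fun hi x)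
  let q : L →ₗ[V] E →₀ V := L.subtype - L.subtype ∘ₗ i ∘ₗ u.rangeRestrict
  have hgq (x : L) : g (p (q x)) = 0 := by
    have := congrArg Prod.fst (hui (u.rangeRestrict x))
    have h' : g (p (i (u.rangeRestrict x))) = g (p x) := this
    simp [q, h']
  let ρ : L →ₗ[V] LinearMap.ker g := (p ∘ₗ q).codRestrict (LinearMap.ker g) hgq
  have hρ (h : LinearMap.ker g) : ρ ⟨s h, hS h⟩ = h := by
    have hu : u ⟨s h, hS h⟩ = 0 := by
      have hph : p (s h) = h := hs h
      ext1 <;> simp [u, hph]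
    have hu' : u.rangeRestrict ⟨s h, hS h⟩ = 0 := Subtype.ext hu
    have hph : p (s h) = h := hs h
    have hpq : p (q ⟨s h, hS h⟩) = h := by simp [q, hu', hph]
    exact Subtype.ext hpq
  refine ⟨Module.Finite.of_surjective ρ fun h => ⟨_, hρ h⟩,
    ρ ∘ₗ Finsupp.restrictDom V V (S : Set E) ∘ₗ s, LinearMap.ext fun h => ?_⟩
  have hr : Finsupp.restrictDom V V (S : Set E) (s h) = ⟨s h, hS h⟩ :=
    LinearMap.congr_fun (Finsupp.restrictDom_comp_subtype (M := V) (R := V) (S : Set E))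
      ⟨s h, hS h⟩
  simp [hr, hρ]

/-- The image of a linear map with a retraction onto its kernel is projective. -/
theorem projective_range_of_retraction {V : Type*} [CommRing V] {E T : Type*} [AddCommGroup E]
    [Module V E] [AddCommGroup T] [Module V T] [Module.Projective V E] (g : E →ₗ[V] T)
    (r : E →ₗ[V] LinearMap.ker g) (hr : r ∘ₗ (LinearMap.ker g).subtype = LinearMap.id) :
    Module.Projective V (LinearMap.range g) := by
  let t : E →ₗ[V] E := LinearMap.id - (LinearMap.ker g).subtype ∘ₗ r
  have ht : LinearMap.ker g ≤ LinearMap.ker t := fun x hx => by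
    have := LinearMap.congr_fun hr ⟨x, hx⟩
    simp only [LinearMap.comp_apply, Submodule.subtype_apply, LinearMap.id_apply] at this
    simp [t, this]
  refine Module.Projective.of_split
    ((LinearMap.ker g).liftQ t ht ∘ₗ g.quotKerEquivRange.symm.toLinearMap) g.rangeRestrict ?_
  ext ⟨_, x, rfl⟩
  have : g.quotKerEquivRange.symm ⟨g x, x, rfl⟩ = (LinearMap.ker g).mkQ x :=
    g.quotKerEquivRange_symm_apply_image x _
  simp [this, t]

theorem PdLeOne.finitePresentation_and_tight {V : Type u} [CommRing V] [IsDomain V]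
    [ValuationRing V] {M : Type v} [AddCommGroup M] [Module V M] (hM : PdLeOne V M)
    {N : Submodule V M} (hN : N.FG) : Module.FinitePresentation V N ∧ Tight V N := by
  obtain ⟨P, _, _, f, _, hf, _⟩ := hM
  have : Module.Finite V N := Module.Finite.iff_fg.mpr hN
  obtain ⟨n, π, hπ⟩ := Module.Finite.exists_fin' V N
  obtain ⟨φ, hφ⟩ := Module.projective_lifting_property f (N.subtype ∘ₗ π) hf
  replace hφ (x) : f (φ x) = π x := LinearMap.congr_fun hφ x
  let g : (Fin n → V) × LinearMap.ker f →ₗ[V] P := φ.coprod (LinearMap.ker f).subtype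
  have hgmem (x : LinearMap.ker g) : φ x.1.1 + x.1.2 = 0 := x.2
  have hinj : Function.Injective
      (LinearMap.fst V (Fin n → V) (LinearMap.ker f) ∘ₗ (LinearMap.ker g).subtype) := by
    rw [← LinearMap.ker_eq_bot, LinearMap.ker_eq_bot']
    intro x hx
    have h1 : x.1.1 = 0 := hx
    have h2 := hgmem x
    rw [h1, map_zero, zero_add] at h2
    exact Subtype.ext (Prod.ext h1 (Subtype.ext h2))
  have hrank : Module.rank V (LinearMap.ker g) < Cardinal.aleph0 := by
    rw [← Cardinal.lift_lt_aleph0]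
    exact (LinearMap.lift_rank_le_of_injective _ hinj).trans_lt
      (Cardinal.lift_lt_aleph0.mpr (Module.rank_lt_aleph0 V (Fin n → V)))
  obtain ⟨hfin, r, hr⟩ := finite_ker_and_exists_retraction g hrank
  constructor
  · refine Module.finitePresentation_of_surjective π hπ ?_
    have hker : LinearMap.ker π = LinearMap.range
        (LinearMap.fst V (Fin n → V) (LinearMap.ker f) ∘ₗ (LinearMap.ker g).subtype) := by
      ext x
      constructor
      · intro hx
        have hx' : φ x ∈ LinearMap.ker f := by
          rw [LinearMap.mem_ker, hφ, LinearMap.mem_ker.mp hx, ZeroMemClass.coe_zero]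
        exact ⟨⟨(x, -⟨φ x, hx'⟩), by simp [g]⟩, rfl⟩
      · rintro ⟨y, rfl⟩
        have := congrArg f (hgmem y)
        rw [map_add, hφ, LinearMap.mem_ker.mp y.1.2.2, add_zero, map_zero] at this
        exact Subtype.ext this
    rw [hker]
    exact Submodule.FG.of_finite
  · have hrange : LinearMap.range g = LinearMap.ker (N.mkQ ∘ₗ f) := by
      ext x
      rw [LinearMap.ker_comp, Submodule.ker_mkQ, Submodule.mem_comap]
      constructor
      · rintro ⟨y, rfl⟩
        have : f (g y) = π y.1 := by simp [g, hφ]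
        rw [this]
        exact (π y.1).2
      · intro hx
        obtain ⟨y, hy⟩ := hπ ⟨f x, hx⟩
        exact ⟨(y, ⟨x - φ y, by simp [hφ, hy]⟩), by simp [g]⟩
    exact ⟨P, _, _, N.mkQ ∘ₗ f, ‹_›, N.mkQ_surjective.comp hf,
      hrange ▸ projective_range_of_retraction g r hr⟩

/-- finitely generated submodules of a module of p.d. ≤ 1 are finitely
presented and tight; in a finitely generated such module the tight submodules are
exactly the finitely generated ones. -/
theorem statement4 (V : Type u) [CommRing V] [IsDomain V] [ValuationRing V]
    (M : Type v) [AddCommGroup M] [Module V M] (hM : PdLeOne V M) :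
    (∀ N : Submodule V M, N.FG → Module.FinitePresentation V ↥N ∧ Tight V N) ∧
    (Module.Finite V M → ∀ N : Submodule V M, Tight V N ↔ N.FG) := by
  refine ⟨fun N hN => hM.finitePresentation_and_tight hN,
    fun _ N => ⟨fun hT => ?_, fun hN => (hM.finitePresentation_and_tight hN).2⟩⟩
  have htop := (PdLeOne.finitePresentation_and_tight hT
    (Module.Finite.fg_top (R := V) (M := M ⧸ N))).1
  have : Module.FinitePresentation V (M ⧸ N) := .of_equiv Submodule.topEquiv
  simpa using Module.FinitePresentation.fg_ker N.mkQ N.mkQ_surjective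
end

section
/- Let V be a valuation domain and M a V-module admitting a countable generating set. Then pd M ≤ 1 if and only if M is the union of an ascending chain M₀ ⊆ M₁ ⊆ ⋯ ⊆ M_n ⊆ ⋯ (n ∈ ℕ) of finitely presented submodules. -/
universe u v

open Pointwise

open Module

section Coherence

variable {V : Type*} [CommRing V] [IsDomain V] [ValuationRing V]

theorem ValuationRing.free_of_isTorsionFree (N : Type*) [AddCommGroup N] [Module V N]
    [Module.Finite V N] [IsTorsionFree V N] : Free V N := by
  have : Flat V N := by
    rw [Flat.flat_iff_torsion_eq_bot_of_isBezout, ← Submodule.isTorsionFree_iff_torsion_eq_bot]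
    infer_instance
  exact free_of_flat_of_isLocalRing

theorem ValuationRing.finitePresentation_of_isTorsionFree (N : Type*) [AddCommGroup N]
    [Module V N] [Module.Finite V N] [IsTorsionFree V N] : FinitePresentation V N := by
  have := free_of_isTorsionFree (V := V) N
  exact finitePresentation_of_projective V N

/-- The kernel of a map from a finitely generated module to a torsion-free one. -/
theorem ValuationRing.fg_ker_of_isTorsionFree {A F : Type*} [AddCommGroup A] [Module V A]
    [AddCommGroup F] [Module V F] [Module.Finite V A] [IsTorsionFree V F] (p : A →ₗ[V] F) :
    (LinearMap.ker p).FG := by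
  have : FinitePresentation V (LinearMap.range p) := finitePresentation_of_isTorsionFree _
  rw [← LinearMap.ker_rangeRestrict]
  exact FinitePresentation.fg_ker _ p.surjective_rangeRestrict

/-- A valuation domain is coherent. -/
theorem ValuationRing.finitePresentation_of_fg {M : Type*} [AddCommGroup M] [Module V M]
    [FinitePresentation V M] (N : Submodule V M) (hN : N.FG) : FinitePresentation V N := by
  obtain ⟨n, f, hf⟩ := Module.Finite.exists_fin' V M
  have hker := FinitePresentation.fg_ker f hf
  have hle : LinearMap.ker f ≤ N.comap f := fun x hx ↦ by
    simp_all
  have hH : (N.comap f).FG := by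
    refine Submodule.fg_of_fg_map_of_fg_inf_ker f ?_ ?_
    · rwa [Submodule.map_comap_eq_of_surjective hf]
    · rwa [inf_eq_right.mpr hle]
  have : Module.Finite V (N.comap f) := .of_fg hH
  have := finitePresentation_of_isTorsionFree (V := V) (N.comap f)
  refine finitePresentation_of_surjective (f.restrict (p := N.comap f) (q := N) fun x hx ↦ hx) ?_ ?_
  · rintro ⟨y, hy⟩
    obtain ⟨x, rfl⟩ := hf y
    exact ⟨⟨x, hy⟩, rfl⟩
  · rw [LinearMap.ker_restrict]
    refine Submodule.fg_of_fg_map_injective _ (N.comap f).subtype_injective ?_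
    rwa [Submodule.map_comap_subtype, inf_eq_right.mpr hle]

/-- A pure submodule of finite rank in a projective module is finitely generated. -/
theorem ValuationRing.fg_ker_of_projective {K F G : Type*} [AddCommGroup K] [Module V K]
    [Projective V K] [AddCommGroup F] [Module V F] [IsTorsionFree V F] [AddCommGroup G]
    [Module V G] [Module.Finite V G] (p : K →ₗ[V] F) (e : K →ₗ[V] G)
    (h : Disjoint (LinearMap.ker p) (LinearMap.ker e)) : (LinearMap.ker p).FG := by
  classical
  obtain ⟨s, hs⟩ := (projective_def' (R := V) (P := K)).mp inferInstance
  obtain ⟨S, hS, hmax⟩ := exists_maximal_linearIndepOn V (Subtype.val : LinearMap.ker p → K)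
  have hfin : Finite S := by
    refine LinearIndependent.finite (R := V) (f := fun i : S ↦ e i.1.1) ?_
    refine LinearIndependent.map (f := e) hS (h.mono_left ?_)
    rw [Submodule.span_le]
    rintro _ ⟨i, rfl⟩
    exact i.1.2
  let J : Set K := ⋃ i : S, ((s i.1.1).support : Set K)
  have hJ : J.Finite := Set.finite_iUnion fun i ↦ Finset.finite_toSet _
  have hspan : Submodule.span V (Subtype.val '' S) ≤ (Finsupp.supported V V J).comap s := by
    rw [Submodule.span_le]
    rintro _ ⟨i, hi, rfl⟩
    exact Set.subset_iUnion (fun i : S ↦ ((s i.1.1).support : Set K)) ⟨i, hi⟩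
  have hle : LinearMap.ker p ≤ Submodule.span V J := by
    intro x hx
    have hxs : s x ∈ Finsupp.supported V V J := by
      by_cases hxS : (⟨x, hx⟩ : LinearMap.ker p) ∈ S
      · exact hspan (Submodule.subset_span ⟨_, hxS, rfl⟩)
      · obtain ⟨a, ha, hax⟩ := hmax _ hxS
        have := hspan hax
        rw [Submodule.mem_comap, map_smul, Finsupp.mem_supported'] at this
        rw [Finsupp.mem_supported']
        intro y hy
        simpa [ha] using this y hy
    rw [show x = Finsupp.linearCombination V id (s x) from (LinearMap.congr_fun hs x).symm]
    rw [← Set.image_id J, Finsupp.span_image_eq_map_linearCombination]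
    exact ⟨_, hxs, rfl⟩
  have : Module.Finite V (Submodule.span V J) := .of_fg (Submodule.fg_span hJ)
  have := (fg_ker_of_isTorsionFree (p.domRestrict (Submodule.span V J))).map
    (Submodule.span V J).subtype
  rwa [LinearMap.ker_domRestrict, Submodule.map_comap_subtype, inf_eq_right.mpr hle] at this

end Coherence

/-- The key step in Schanuel's lemma. -/
theorem Module.Projective.ker_of_ker {R M P Q : Type*} [CommRing R] [AddCommGroup M] [Module R M]
    [AddCommGroup P] [Module R P] [AddCommGroup Q] [Module R Q] [Projective R P] [Projective R Q]
    (f : P →ₗ[R] M) (g : Q →ₗ[R] M) (hf : Function.Surjective f) (hg : Function.Surjective g)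
    [Projective R (LinearMap.ker f)] : Projective R (LinearMap.ker g) := by
  obtain ⟨l, hl⟩ := projective_lifting_property g f hg
  obtain ⟨h, hh⟩ := projective_lifting_property f g hf
  have hl' (x) : g (l x) = f x := LinearMap.congr_fun hl x
  have hh' (x) : f (h x) = g x := LinearMap.congr_fun hh x
  let α : LinearMap.ker g →ₗ[R] LinearMap.ker f × Q :=
    (h.restrict fun x hx ↦ by simp_all).prod (LinearMap.ker g).subtype
  let β : LinearMap.ker f × Q →ₗ[R] LinearMap.ker g :=
    LinearMap.codRestrict _
      ((l ∘ₗ (LinearMap.ker f).subtype).coprod (LinearMap.id - l ∘ₗ h)) fun x ↦ by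
        simp [hl', hh']
  refine Projective.of_split α β ?_
  ext x
  exact add_sub_cancel (l (h x)) (x : Q)

theorem pdLeOne_iff_projective_ker {V : Type u} [CommRing V] {M : Type v} [AddCommGroup M]
    [Module V M] {Q : Type*} [AddCommGroup Q] [Module V Q] [Projective V Q] (g : Q →ₗ[V] M)
    (hg : Function.Surjective g) : PdLeOne V M ↔ Projective V (LinearMap.ker g) := by
  constructor
  · rintro ⟨P, _, _, f, _, hf, _⟩
    exact Projective.ker_of_ker f g hf hg
  · intro _
    refine ⟨M →₀ V, inferInstance, inferInstance, Finsupp.linearCombination V id, inferInstance,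
      Finsupp.linearCombination_id_surjective V M, ?_⟩
    exact Projective.ker_of_ker g _ hg (Finsupp.linearCombination_id_surjective V M)

/-- A submodule of `ℕ →₀ R` is free if, for every `n`, the `n`-th coordinates of its elements
supported in `Set.Iic n` form a principal ideal. -/
theorem Module.Free.of_isPrincipal_leadingCoeff {R : Type*} [CommRing R] [IsDomain R]
    (K : Submodule R (ℕ →₀ R))
    (h : ∀ n, ((K ⊓ Finsupp.supported R R (Set.Iic n)).map (Finsupp.lapply n)).IsPrincipal) :
    Free R K := by
  choose a ha using fun n ↦ (h n).principal
  have hc (n) : ∃ c ∈ K ⊓ Finsupp.supported R R (Set.Iic n), c n = a n := by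
    have : a n ∈ (K ⊓ Finsupp.supported R R (Set.Iic n)).map (Finsupp.lapply n) := by
      rw [ha n]
      exact Submodule.mem_span_singleton_self _
    simpa using this
  choose c hc hca using hc
  have hzero {m n} (hmn : m < n) : c m n = 0 :=
    (Finsupp.mem_supported' R _).mp (hc m).2 n (by simpa using hmn)
  let b : {n // a n ≠ 0} → K := fun n ↦ ⟨c n, (hc n).1⟩
  have hli : LinearIndependent R b := by
    refine LinearIndependent.of_comp K.subtype (linearIndependent_iff.mpr fun l hl ↦ ?_)
    by_contra hne
    obtain ⟨m, hm, hmax⟩ := l.support.exists_max_image id (Finsupp.support_nonempty_iff.mpr hne)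
    have hsum : ∑ i ∈ l.support, l i * c i m = 0 := by
      have := congrArg (fun x ↦ x (m : ℕ)) hl
      simpa [Finsupp.linearCombination_apply, Finsupp.sum, b, Finsupp.finsetSum_apply] using this
    rw [Finset.sum_eq_single_of_mem m hm, hca, mul_eq_zero] at hsum
    · exact hsum.elim (Finsupp.mem_support_iff.mp hm) m.2
    · intro i hi him
      have hlt : (i : ℕ) < m := lt_of_le_of_ne (hmax i hi) (Subtype.val_injective.ne him)
      rw [hzero hlt, mul_zero]
  have hmem (n : ℕ) : c n ∈ K := (hc n).1
  have hspan (n : ℕ) (x : ℕ →₀ R) (hx : x ∈ K) (hxn : x ∈ Finsupp.supported R R (Set.Iio n)) :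
      x ∈ (Submodule.span R (Set.range b)).map K.subtype := by
    induction n generalizing x with
    | zero =>
      have : x = 0 := by
        ext i
        exact (Finsupp.mem_supported' R _).mp hxn i (by simp)
      exact this ▸ zero_mem _
    | succ n ih =>
      have hxa : x n ∈ (K ⊓ Finsupp.supported R R (Set.Iic n)).map (Finsupp.lapply n) :=
        ⟨x, ⟨hx, Finsupp.supported_mono (fun i hi ↦ Nat.lt_succ_iff.mp hi) hxn⟩, rfl⟩
      rw [ha n, Submodule.mem_span_singleton] at hxa
      obtain ⟨r, hr⟩ := hxa
      by_cases han : a n = 0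
      · refine ih x hx ((Finsupp.mem_supported' R _).mpr fun i hi ↦ ?_)
        obtain rfl | hin := (not_lt.mp (Set.mem_Iio.not.mp hi)).eq_or_lt
        · simp [← hr, han]
        · exact (Finsupp.mem_supported' R _).mp hxn i (by simpa using hin)
      · rw [← sub_add_cancel x (r • c n)]
        refine add_mem (ih _ (sub_mem hx (K.smul_mem _ (hmem n)))
          ((Finsupp.mem_supported' R _).mpr fun i hi ↦ ?_)) (Submodule.smul_mem _ _
            ⟨b ⟨n, han⟩, Submodule.subset_span ⟨_, rfl⟩, rfl⟩)
        obtain rfl | hin := (not_lt.mp (Set.mem_Iio.not.mp hi)).eq_or_lt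
        · simp [← hr, hca]
        · have := (Finsupp.mem_supported' R _).mp hxn i (by simpa using hin)
          simp [this, hzero hin]
  refine Free.of_basis (Basis.mk hli fun x _ ↦ ?_)
  obtain ⟨y, hy, hyx⟩ := hspan (x.1.support.sup id + 1) x x.2 fun i hi ↦
    Nat.lt_succ_iff.mpr (Finset.le_sup (f := id) hi)
  rwa [← Subtype.ext hyx]

section Relations

variable {V : Type*} [CommRing V] {M : Type*} [AddCommGroup M] [Module V M] {ι : Type*} (x : ι → M)

theorem map_ker_linearCombination_eq_inf_supported (s : Set ι) :
    (LinearMap.ker (Finsupp.linearCombination V fun i : s ↦ x i)).map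
      (Finsupp.lmapDomain V V Subtype.val) =
    LinearMap.ker (Finsupp.linearCombination V x) ⊓ Finsupp.supported V V s := by
  have hcomp : (Finsupp.linearCombination V fun i : s ↦ x i) =
      Finsupp.linearCombination V x ∘ₗ Finsupp.lmapDomain V V Subtype.val := by
    ext i
    simp
  rw [hcomp, LinearMap.ker_comp, Submodule.map_comap_eq, Finsupp.range_lmapDomain,
    inf_comm, Finsupp.supported_eq_span_single]
  congr 2
  ext y
  simp

theorem finitePresentation_span_iff (s : Set ι) [Finite s] :
    FinitePresentation V (Submodule.span V (x '' s)) ↔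
      (LinearMap.ker (Finsupp.linearCombination V x) ⊓ Finsupp.supported V V s).FG := by
  have hr : LinearMap.range (Finsupp.linearCombination V fun i : s ↦ x i) =
      Submodule.span V (x '' s) := by
    rw [Finsupp.range_linearCombination, Set.image_eq_range]
  rw [← map_ker_linearCombination_eq_inf_supported, ← hr]
  rw [Submodule.fg_map_iff _ (Finsupp.mapDomain_injective Subtype.val_injective)]
  rw [← FinitePresentation.fg_ker_iff _ (LinearMap.surjective_rangeRestrict _),
    LinearMap.ker_rangeRestrict]

theorem ValuationRing.fg_relations_inf_supported [IsDomain V] [ValuationRing V]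
    [Projective V (LinearMap.ker (Finsupp.linearCombination V x))] (s : Set ι) [Finite s] :
    (LinearMap.ker (Finsupp.linearCombination V x) ⊓ Finsupp.supported V V s).FG := by
  set K := LinearMap.ker (Finsupp.linearCombination V x)
  let p : K →ₗ[V] (sᶜ : Set ι) →₀ V := Finsupp.lsubtypeDomain sᶜ ∘ₗ K.subtype
  let e : K →ₗ[V] s →₀ V := Finsupp.lsubtypeDomain s ∘ₗ K.subtype
  have hp (y : K) : y ∈ LinearMap.ker p ↔ y.1 ∈ Finsupp.supported V V s := by
    simp [p, Finsupp.mem_supported', Finsupp.ext_iff, Finsupp.lsubtypeDomain_apply]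
  have he (y : K) : y ∈ LinearMap.ker e ↔ ∀ i ∈ s, y.1 i = 0 := by
    simp [e, Finsupp.ext_iff, Finsupp.lsubtypeDomain_apply]
  have hpe : Disjoint (LinearMap.ker p) (LinearMap.ker e) := by
    rw [Submodule.disjoint_def]
    intro y hy hy'
    rw [hp, Finsupp.mem_supported'] at hy
    rw [he] at hy'
    ext i
    by_cases hi : i ∈ s
    exacts [hy' i hi, hy i hi]
  have hker : LinearMap.ker p = (Finsupp.supported V V s).comap K.subtype := by
    ext y
    exact hp y
  have hfg := fg_ker_of_projective (V := V) (K := K) (F := (sᶜ : Set ι) →₀ V) (G := s →₀ V)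
    p e hpe
  rw [hker] at hfg
  rw [← Submodule.map_comap_subtype]
  exact hfg.map K.subtype

end Relations

/-- a countably generated module over a valuation domain has p.d. ≤ 1 iff
it is the union of an ascending chain of finitely presented submodules. -/
theorem statement6 (V : Type u) [CommRing V] [IsDomain V] [ValuationRing V]
    (M : Type v) [AddCommGroup M] [Module V M]
    (hcg : ∃ S : Set M, S.Countable ∧ Submodule.span V S = ⊤) :
    PdLeOne V M ↔
      ∃ f : ℕ → Submodule V M, Monotone f ∧
        (∀ n, Module.FinitePresentation V ↥(f n)) ∧ (⨆ n, f n) = ⊤ := by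
  obtain ⟨S, hS, hspan⟩ := hcg
  obtain ⟨x, hx⟩ : ∃ x : ℕ → M, Submodule.span V (Set.range x) = ⊤ := by
    obtain ⟨x, hx⟩ := (hS.insert 0).exists_eq_range (Set.insert_nonempty 0 S)
    exact ⟨x, by rw [← hx, Submodule.span_insert_zero, hspan]⟩
  have hsurj : Function.Surjective (Finsupp.linearCombination V x) := by
    rw [← LinearMap.range_eq_top, Finsupp.range_linearCombination, hx]
  rw [pdLeOne_iff_projective_ker _ hsurj]
  constructor
  · intro _
    refine ⟨fun n ↦ Submodule.span V (x '' Set.Iic n), fun m n hmn ↦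
      Submodule.span_mono (Set.image_mono (Set.Iic_subset_Iic.mpr hmn)), fun n ↦ ?_, ?_⟩
    · rw [finitePresentation_span_iff]
      exact ValuationRing.fg_relations_inf_supported x _
    · rw [← Submodule.span_iUnion, ← Set.image_iUnion, Set.iUnion_Iic, Set.image_univ, hx]
  · rintro ⟨f, hmono, hfp, htop⟩
    have : Free V (LinearMap.ker (Finsupp.linearCombination V x)) := by
      refine Free.of_isPrincipal_leadingCoeff _ fun n ↦ IsBezout.isPrincipal_of_FG _
        (Submodule.FG.map _ ?_)
      rw [← finitePresentation_span_iff]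
      have hfg : (Submodule.span V (x '' Set.Iic n)).FG :=
        Submodule.fg_span ((Set.finite_Iic n).image x)
      obtain ⟨m, hm⟩ : ∃ m, Submodule.span V (x '' Set.Iic n) ≤ f m := by
        have hmem (i) : ∃ m, x i ∈ f m := by
          rw [← Submodule.mem_iSup_of_directed _ hmono.directed_le, htop]
          trivial
        choose k hk using hmem
        refine ⟨(Finset.Iic n).sup k, Submodule.span_le.mpr ?_⟩
        rintro _ ⟨i, hi, rfl⟩
        exact hmono (Finset.le_sup (Finset.mem_Iic.mpr hi)) (hk i)
      have := ValuationRing.finitePresentation_of_fg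
        ((Submodule.span V (x '' Set.Iic n)).comap (f m).subtype)
        (Submodule.fg_of_fg_map_injective _ (f m).subtype_injective (by
          rwa [Submodule.map_comap_subtype, inf_eq_right.mpr hm]))
      exact FinitePresentation.of_equiv (Submodule.comapSubtypeEquivOfLe hm)
    infer_instance
end

section
/- Let V be a valuation domain, M a V-module with pd M ≤ 1, and A, B tight submodules of M such that B admits a countable generating set. Then: (a) C = A ∩ B admits a countable generating set and C is tight in B, tight in A, and tight in M; (b) pd(A + B) ≤ 1 and A is tight in A + B, i.e., pd((A+B)/A) ≤ 1. -/
universe u v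

open Pointwise

section Homological

variable {V : Type u} [CommRing V]

/-- A form of Schanuel's lemma. -/
theorem projective_ker_of_projective_ker {M P Q : Type*} [AddCommGroup M] [Module V M]
    [AddCommGroup P] [Module V P] [AddCommGroup Q] [Module V Q]
    [Module.Projective V P] [Module.Projective V Q]
    {f : P →ₗ[V] M} (hf : Function.Surjective f) {g : Q →ₗ[V] M} (hg : Function.Surjective g)
    (h : Module.Projective V (LinearMap.ker f)) : Module.Projective V (LinearMap.ker g) := by
  obtain ⟨a, ha⟩ := Module.projective_lifting_property f g hf
  obtain ⟨b, hb⟩ := Module.projective_lifting_property g f hg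
  have ha' (q : Q) : f (a q) = g q := LinearMap.congr_fun ha q
  have hb' (p : P) : g (b p) = f p := LinearMap.congr_fun hb p
  let i : LinearMap.ker g →ₗ[V] LinearMap.ker f × Q :=
    ((-(a ∘ₗ (LinearMap.ker g).subtype)).codRestrict _ fun q ↦ by simp [ha']).prod
      (LinearMap.ker g).subtype
  let s : LinearMap.ker f × Q →ₗ[V] LinearMap.ker g :=
    (LinearMap.snd V _ Q - b ∘ₗ ((LinearMap.ker f).subtype ∘ₗ LinearMap.fst V _ Q +
      a ∘ₗ LinearMap.snd V _ Q)).codRestrict _ fun q ↦ by simp [ha', hb']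
  refine Module.Projective.of_split i s (LinearMap.ext fun z ↦ Subtype.ext ?_)
  change (z : Q) - b (-a z + a z) = z
  simp

theorem pdLeOne_iff {M : Type v} [AddCommGroup M] [Module V M] {P : Type*} [AddCommGroup P]
    [Module V P] [Module.Projective V P] {f : P →ₗ[V] M} (hf : Function.Surjective f) :
    PdLeOne V M ↔ Module.Projective V (LinearMap.ker f) := by
  constructor
  · rintro ⟨Q, _, _, g, _, hg, h⟩
    exact projective_ker_of_projective_ker hg hf h
  · intro h
    have hg := Finsupp.linearCombination_id_surjective V M
    exact ⟨M →₀ V, inferInstance, inferInstance, _, inferInstance, hg,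
      projective_ker_of_projective_ker hf hg h⟩

theorem PdLeOne.of_equiv {M N : Type v} [AddCommGroup M] [Module V M] [AddCommGroup N] [Module V N]
    (e : M ≃ₗ[V] N) (h : PdLeOne V M) : PdLeOne V N := by
  obtain ⟨P, _, _, f, _, hf, hk⟩ := h
  refine ⟨P, inferInstance, inferInstance, e.toLinearMap ∘ₗ f, inferInstance,
    e.surjective.comp hf, ?_⟩
  rwa [LinearEquiv.ker_comp]

theorem pdLeOne_iff_pdLeOne_ker {N X : Type v} [AddCommGroup N] [Module V N] [AddCommGroup X]
    [Module V X] {p : N →ₗ[V] X} (hp : Function.Surjective p) (hX : PdLeOne V X) :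
    PdLeOne V N ↔ PdLeOne V (LinearMap.ker p) := by
  have hf := Finsupp.linearCombination_id_surjective V N
  set f := Finsupp.linearCombination V (id : N → N)
  have hL : Module.Projective V (LinearMap.ker (p ∘ₗ f)) :=
    (pdLeOne_iff (hp.comp hf : Function.Surjective (p ∘ₗ f))).1 hX
  let g : LinearMap.ker (p ∘ₗ f) →ₗ[V] LinearMap.ker p := f.restrict fun x hx ↦ hx
  have hg : Function.Surjective g := by
    rintro ⟨y, hy⟩
    obtain ⟨x, rfl⟩ := hf y
    exact ⟨⟨x, hy⟩, rfl⟩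
  let e : LinearMap.ker g ≃ₗ[V] LinearMap.ker f :=
    { toFun x := ⟨x.1.1, congrArg Subtype.val x.2⟩
      map_add' _ _ := rfl
      map_smul' _ _ := rfl
      invFun x := ⟨⟨x.1, by simp [LinearMap.mem_ker.1 x.2]⟩, Subtype.ext x.2⟩
      left_inv _ := rfl
      right_inv _ := rfl }
  rw [pdLeOne_iff hf, pdLeOne_iff (P := LinearMap.ker (p ∘ₗ f)) (f := g) hg]
  exact ⟨fun _ ↦ .of_equiv' e.symm, fun _ ↦ .of_equiv' e⟩

variable {M : Type v} [AddCommGroup M] [Module V M]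

theorem pdLeOne_iff_of_tight {A : Submodule V M} (hA : Tight V A) :
    PdLeOne V M ↔ PdLeOne V A := by
  rw [pdLeOne_iff_pdLeOne_ker A.mkQ_surjective hA, Submodule.ker_mkQ]

theorem tightIn_iff_pdLeOne_map (C B : Submodule V M) :
    TightIn V C B ↔ PdLeOne V (B.map C.mkQ) := by
  have hk : LinearMap.ker (C.mkQ ∘ₗ B.subtype) = C.comap B.subtype := by
    rw [LinearMap.ker_comp, Submodule.ker_mkQ]
  have hr : LinearMap.range (C.mkQ ∘ₗ B.subtype) = B.map C.mkQ := by
    rw [LinearMap.range_comp, Submodule.range_subtype]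
  rw [TightIn, Tight, ← hk, ← hr]
  exact ⟨.of_equiv (LinearMap.quotKerEquivRange _), .of_equiv (LinearMap.quotKerEquivRange _).symm⟩

theorem tight_iff_tightIn {C B : Submodule V M} (hCB : C ≤ B) (hB : Tight V B) :
    Tight V C ↔ TightIn V C B := by
  rw [Tight, pdLeOne_iff_pdLeOne_ker (Submodule.factor_surjective hCB) hB,
    tightIn_iff_pdLeOne_map, Submodule.factor, Submodule.mapQ, Submodule.ker_liftQ,
    LinearMap.comp_id, Submodule.ker_mkQ]

theorem tightIn_inf_left {A B : Submodule V M} : TightIn V (A ⊓ B) B ↔ TightIn V A B := by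
  rw [TightIn, TightIn, Submodule.comap_inf, Submodule.comap_subtype_self, inf_top_eq]

theorem tightIn_sup_right {A B : Submodule V M} : TightIn V A (A ⊔ B) ↔ TightIn V A B := by
  rw [tightIn_iff_pdLeOne_map, tightIn_iff_pdLeOne_map, Submodule.map_sup, Submodule.mkQ_map_self,
    bot_sup_eq]

end Homological

section CountableRank

variable {V : Type u} [CommRing V] [IsDomain V]

theorem exists_eq_smul_of_ne_zero [ValuationRing V] {ι : Type*} {x : ι →₀ V} (hx : x ≠ 0) :
    ∃ j, x j ≠ 0 ∧ ∃ e : ι →₀ V, x = x j • e := by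
  classical
  have key (t : Finset ι) (ht : t.Nonempty) : ∃ j ∈ t, ∀ i ∈ t, x j ∣ x i := by
    induction ht using Finset.Nonempty.cons_induction with
    | singleton a => exact ⟨a, by simp⟩
    | cons a s ha hs ih =>
      obtain ⟨j, hj, h⟩ := ih
      rcases ValuationRing.dvd_total (x j) (x a) with hd | hd
      · exact ⟨j, by simp [hj], by simpa using ⟨hd, h⟩⟩
      · exact ⟨a, by simp, by simpa using fun i hi ↦ hd.trans (h i hi)⟩
  obtain ⟨j, hj, h⟩ := key x.support (Finsupp.support_nonempty_iff.2 hx)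
  have hj0 : x j ≠ 0 := Finsupp.mem_support_iff.1 hj
  choose! e he using h
  refine ⟨j, hj0, Finsupp.onFinset x.support (fun i ↦ if x i = 0 then 0 else e i) fun i hi ↦ ?_, ?_⟩
  · by_contra h
    exact hi (if_pos (Finsupp.notMem_support_iff.1 h))
  · ext i
    by_cases hi : x i = 0
    · simp [hi]
    · simpa [hi] using he i (Finsupp.mem_support_iff.2 hi)

section Pure

variable [ValuationRing V] {K : Type*} [AddCommGroup K] [Module V K] {ι : Type*}
  {i : K →ₗ[V] ι →₀ V}

/-- One step of Gaussian elimination: an idempotent endomorphism of a pure submodule of a free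
module is modified by a map of rank at most one to kill a given element. -/
theorem exists_elimination_step (hi : Function.Injective i)
    (hpure : ∀ (c : V) (x : K) (e : ι →₀ V), c ≠ 0 → i x = c • e → ∃ z, x = c • z)
    (π : K →ₗ[V] K) (hπ : π ∘ₗ π = π) (s : K) :
    ∃ (φ : K →ₗ[V] V) (b : K), φ ∘ₗ π = φ ∧ π b = b ∧ φ b • b = b ∧ π s = φ s • b := by
  have hππ (x : K) : π (π x) = π x := LinearMap.congr_fun hπ x
  by_cases hs : π s = 0
  · exact ⟨0, 0, by simp [hs]⟩
  obtain ⟨j, hj, e, he⟩ := exists_eq_smul_of_ne_zero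
    (x := i (π s)) (by rwa [Ne, map_eq_zero_iff i hi])
  obtain ⟨b, hb⟩ := hpure _ _ _ hj he
  set c := i (π s) j with hc
  have hcancel {x y : K} (h : c • x = c • y) : x = y :=
    hi (smul_right_injective _ hj (by simpa using congrArg i h))
  have hπb : π b = b := hcancel (by rw [← map_smul, ← hb, hππ])
  have hb1 : i b j = 1 := by
    have h : i (π s) j = c * i b j := by
      conv_lhs => rw [hb]
      simp
    exact mul_left_cancel₀ hj (by rw [← h, mul_one])
  refine ⟨Finsupp.lapply j ∘ₗ i ∘ₗ π, b, ?_, hπb, ?_, ?_⟩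
  · ext x
    simp [hππ]
  · simp [hπb, hb1]
  · simpa [← hc] using hb

theorem projective_and_countably_generated_of_pure (hi : Function.Injective i)
    (hpure : ∀ (c : V) (x : K) (e : ι →₀ V), c ≠ 0 → i x = c • e → ∃ z, x = c • z)
    (s : ℕ → K) (hs : ∀ x, ∃ c : V, c ≠ 0 ∧ c • x ∈ Submodule.span V (Set.range s)) :
    Module.Projective V K ∧ ∃ b : ℕ → K, Submodule.span V (Set.range b) = ⊤ := by
  choose Φ β h1 h2 h3 h4 using exists_elimination_step hi hpure
  let step (n : ℕ) (p : {π : K →ₗ[V] K // π ∘ₗ π = π}) : {π : K →ₗ[V] K // π ∘ₗ π = π} :=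
    ⟨p.1 - (Φ p.1 p.2 (s n)).smulRight (β p.1 p.2 (s n)), by
      have hππ (x : K) : p.1 (p.1 x) = p.1 x := LinearMap.congr_fun p.2 x
      have hφ (x : K) := LinearMap.congr_fun (h1 p.1 p.2 (s n)) x
      have hb := h2 p.1 p.2 (s n)
      have hbb := h3 p.1 p.2 (s n)
      simp only [LinearMap.comp_apply] at hφ
      ext x
      simp [hππ, hφ, hb, sub_smul, mul_smul, hbb]⟩
  let p (n : ℕ) : {π : K →ₗ[V] K // π ∘ₗ π = π} :=
    Nat.rec ⟨LinearMap.id, LinearMap.id_comp _⟩ step n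
  let φ (n : ℕ) : K →ₗ[V] V := Φ (p n).1 (p n).2 (s n)
  let b (n : ℕ) : K := β (p n).1 (p n).2 (s n)
  have p_zero (x : K) : (p 0).1 x = x := rfl
  have p_succ (n : ℕ) (x : K) : (p (n + 1)).1 x = (p n).1 x - φ n x • b n := rfl
  have hφ (n : ℕ) (x : K) : φ n ((p n).1 x) = φ n x := LinearMap.congr_fun (h1 _ _ _) x
  have hkill (n : ℕ) : (p (n + 1)).1 (s n) = 0 := by
    rw [p_succ, sub_eq_zero]
    exact h4 _ _ _
  have hmono (m : ℕ) (x : K) (hx : (p m).1 x = 0) (n : ℕ) (hn : m ≤ n) : (p n).1 x = 0 := by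
    induction n, hn using Nat.le_induction with
    | base => exact hx
    | succ n _ ih => rw [p_succ, ← hφ, ih]; simp
  have hspan (y : K) (hy : y ∈ Submodule.span V (Set.range s)) : ∃ n, (p n).1 y = 0 := by
    induction hy using Submodule.span_induction with
    | mem x h =>
      obtain ⟨n, rfl⟩ := h
      exact ⟨n + 1, hkill n⟩
    | zero => exact ⟨0, map_zero _⟩
    | add x y _ _ hx hy =>
      obtain ⟨m, hm⟩ := hx
      obtain ⟨n, hn⟩ := hy
      exact ⟨max m n, by
        rw [map_add, hmono m x hm _ (le_max_left _ _), hmono n y hn _ (le_max_right _ _), add_zero]⟩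
    | smul a x _ hx =>
      obtain ⟨n, hn⟩ := hx
      exact ⟨n, by rw [map_smul, hn, smul_zero]⟩
  have hvanish (x : K) : ∃ n, (p n).1 x = 0 := by
    obtain ⟨c, hc, hx⟩ := hs x
    obtain ⟨n, hn⟩ := hspan _ hx
    refine ⟨n, hi (smul_right_injective _ hc ?_)⟩
    simpa using congrArg i hn
  have hsum (n : ℕ) (x : K) : x = (p n).1 x + ∑ k ∈ Finset.range n, φ k x • b k := by
    induction n with
    | zero => simp [p_zero]
    | succ n ih =>
      rw [Finset.sum_range_succ, p_succ]
      nth_rewrite 1 [ih]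
      abel
  choose N hN using hvanish
  have hφN (x : K) (n : ℕ) (hn : φ n x ≠ 0) : n ∈ Finset.range (N x) := by
    by_contra h
    apply hn
    rw [← hφ, hmono _ x (hN x) n (by simpa using h), map_zero]
  let σ : K →ₗ[V] ℕ →₀ V :=
    { toFun x := Finsupp.onFinset (Finset.range (N x)) (fun n ↦ φ n x) (hφN x)
      map_add' x y := Finsupp.ext fun n ↦ map_add (φ n) x y
      map_smul' a x := Finsupp.ext fun n ↦ map_smul (φ n) a x }
  have hσ : Finsupp.linearCombination V b ∘ₗ σ = LinearMap.id := by
    ext x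
    have h := hsum (N x) x
    rw [hN, zero_add] at h
    simp only [LinearMap.comp_apply, LinearMap.id_apply]
    conv_rhs => rw [h]
    exact Finsupp.onFinset_sum (hφN x) fun n ↦ zero_smul V (b n)
  refine ⟨.of_split σ _ hσ, b, ?_⟩
  rw [← Finsupp.range_linearCombination]
  exact LinearMap.range_eq_top.2 fun x ↦ ⟨σ x, LinearMap.congr_fun hσ x⟩

end Pure

/-- A submodule of a free module of countable rank is torsion over a countably generated
submodule. -/
theorem exists_nat_smul_mem_span (K : Submodule V (ℕ →₀ V)) :
    ∃ s : ℕ → K, ∀ x, ∃ c : V, c ≠ 0 ∧ c • x ∈ Submodule.span V (Set.range s) := by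
  obtain ⟨S, hS, hmax⟩ := exists_maximal_linearIndepOn V (id : K → K)
  have hS' : LinearIndependent V fun x : S ↦ (x : ℕ →₀ V) :=
    LinearIndependent.map' (v := fun x : S ↦ (x : K)) hS K.subtype K.ker_subtype
  have hc : S.Countable := by
    have h := hS'.cardinal_lift_le_rank
    simpa using h
  obtain ⟨s, hs⟩ := (hc.insert 0).exists_eq_range (Set.insert_nonempty _ _)
  refine ⟨s, fun x ↦ ?_⟩
  rw [← hs, Submodule.span_insert_zero]
  by_cases hx : x ∈ S
  · exact ⟨1, one_ne_zero, by simpa using Submodule.subset_span hx⟩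
  · simpa using hmax x hx

theorem PdLeOne.projective_ker_and_countably_generated [ValuationRing V] {N : Type v}
    [AddCommGroup N] [Module V N] (hN : PdLeOne V N) (γ : (ℕ →₀ V) →ₗ[V] N) :
    Module.Projective V (LinearMap.ker γ) ∧
      ∃ b : ℕ → LinearMap.ker γ, Submodule.span V (Set.range b) = ⊤ := by
  have hf := Finsupp.linearCombination_id_surjective V N
  set f := Finsupp.linearCombination V (id : N → N)
  have hfγ : Function.Surjective (f.coprod γ) := fun y ↦ by
    obtain ⟨x, rfl⟩ := hf y
    exact ⟨(x, 0), by simp⟩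
  have hP : Module.Projective V (LinearMap.ker (f.coprod γ)) := (pdLeOne_iff hfγ).1 hN
  obtain ⟨σ, hσ⟩ := Module.projective_def'.1 hP
  let j : LinearMap.ker γ →ₗ[V] LinearMap.ker (f.coprod γ) :=
    (LinearMap.inr V (N →₀ V) (ℕ →₀ V)).restrict fun x hx ↦ by simpa using hx
  have hj : Function.Injective j := fun x y h ↦
    Subtype.ext (congrArg (fun z : LinearMap.ker (f.coprod γ) ↦ z.1.2) h)
  have hσ' : Function.Injective σ :=
    Function.LeftInverse.injective (g := Finsupp.linearCombination V id) fun x ↦ LinearMap.congr_fun hσ x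
  obtain ⟨s, hs⟩ := exists_nat_smul_mem_span (LinearMap.ker γ)
  refine projective_and_countably_generated_of_pure (i := σ ∘ₗ j) (hσ'.comp hj) ?_ s hs
  intro c x e hc hx
  obtain ⟨⟨⟨a, z⟩, haz⟩, hr⟩ : ∃ r : LinearMap.ker (f.coprod γ), j x = c • r :=
    ⟨Finsupp.linearCombination V id e, by
      rw [← map_smul, ← hx]
      exact (LinearMap.congr_fun hσ (j x)).symm⟩
  have h1 : (0 : N →₀ V) = c • a := congrArg (fun z ↦ z.1.1) hr
  have h2 : (x : ℕ →₀ V) = c • z := congrArg (fun z ↦ z.1.2) hr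
  have ha : a = 0 := (smul_eq_zero.1 h1.symm).resolve_left hc
  subst ha
  exact ⟨⟨z, by simpa using haz⟩, Subtype.ext h2⟩

end CountableRank

/-- intersections and sums of a tight submodule with a countably
generated tight submodule. -/
theorem statement7 (V : Type u) [CommRing V] [IsDomain V] [ValuationRing V]
    (M : Type v) [AddCommGroup M] [Module V M] (hM : PdLeOne V M)
    (A B : Submodule V M) (hA : Tight V A) (hB : Tight V B)
    (hBcg : ∃ S : Set M, S.Countable ∧ Submodule.span V S = B) :
    -- (a) A ⊓ B is countably generated, and tight in B, in A and in M
    ((∃ S : Set M, S.Countable ∧ Submodule.span V S = A ⊓ B) ∧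
      TightIn V (A ⊓ B) B ∧ TightIn V (A ⊓ B) A ∧ Tight V (A ⊓ B)) ∧
    -- (b) A + B has p.d. ≤ 1 and A is tight in it
    (PdLeOne V ↥(A ⊔ B) ∧ TightIn V A (A ⊔ B)) := by
  obtain ⟨S, hS, rfl⟩ := hBcg
  obtain ⟨s, hs⟩ := (hS.insert 0).exists_eq_range (Set.insert_nonempty _ _)
  rw [← Submodule.span_insert_zero, hs, ← Finsupp.range_linearCombination] at hB ⊢
  set β := Finsupp.linearCombination V s
  obtain ⟨hproj, b, hb⟩ :=
    PdLeOne.projective_ker_and_countably_generated (N := M ⧸ A) hA (A.mkQ ∘ₗ β)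
  have hAB : TightIn V A (LinearMap.range β) := by
    rw [tightIn_iff_pdLeOne_map, ← LinearMap.range_comp,
      pdLeOne_iff (LinearMap.surjective_rangeRestrict _), LinearMap.ker_rangeRestrict]
    exact hproj
  have hCB : TightIn V (A ⊓ LinearMap.range β) (LinearMap.range β) := tightIn_inf_left.2 hAB
  have hC : Tight V (A ⊓ LinearMap.range β) := (tight_iff_tightIn inf_le_right hB).2 hCB
  have hsup : TightIn V A (A ⊔ LinearMap.range β) := tightIn_sup_right.2 hAB
  refine ⟨⟨⟨Set.range fun n ↦ β (b n), Set.countable_range _, ?_⟩, hCB,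
    (tight_iff_tightIn inf_le_left hA).1 hC, hC⟩, ?_, hsup⟩
  · have h := congrArg (Submodule.map (β ∘ₗ (LinearMap.ker (A.mkQ ∘ₗ β)).subtype)) hb
    rw [Submodule.map_span, ← Set.range_comp, Submodule.map_top, LinearMap.range_comp,
      Submodule.range_subtype] at h
    refine h.trans ?_
    rw [LinearMap.ker_comp, Submodule.ker_mkQ, Submodule.map_comap_eq, inf_comm]
  · rw [pdLeOne_iff_of_tight hsup]
    exact ((pdLeOne_iff_of_tight hA).1 hM).of_equiv
      (Submodule.comapSubtypeEquivOfLe le_sup_left).symm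
end

section
/- Let V be a valuation domain, M a V-module with pd M ≤ 1, and N any submodule of M. Then N is contained in a tight submodule N* of M such that gen N* ≤ max(gen N, ℵ₀). -/
universe u v

open Pointwise

/-- the minimal cardinality of a generating set of an `V`-module `M`. -/
noncomputable def gen (V : Type u) [Semiring V] (M : Type v) [AddCommMonoid M] [Module V M] :
    Cardinal.{v} :=
  ⨅ S : {S : Set M // Submodule.span V S = ⊤}, Cardinal.mk ↥S.1

open Cardinal

section Gen

variable {R : Type*} [Semiring R] {M : Type v} [AddCommMonoid M] [Module R M]

theorem gen_span_le (T : Set M) : gen R ↥(Submodule.span R T) ≤ #T := by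
  refine (ciInf_le' _ ⟨((↑) : Submodule.span R T → M) ⁻¹' T,
    Submodule.span_span_coe_preimage⟩).trans ?_
  exact mk_preimage_of_injective _ _ Subtype.val_injective

theorem exists_span_eq_mk_le_gen (N : Submodule R M) :
    ∃ T : Set M, Submodule.span R T = N ∧ #T ≤ gen R ↥N := by
  have : Nonempty {S : Set N // Submodule.span R S = ⊤} := ⟨⟨Set.univ, Submodule.span_univ⟩⟩
  obtain ⟨⟨S, hS⟩, h⟩ := ciInf_mem fun S : {S : Set N // Submodule.span R S = ⊤} => #S.1
  refine ⟨N.subtype '' S, ?_, mk_image_le.trans h.le⟩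
  rw [Submodule.span_image, hS, Submodule.map_subtype_top]

end Gen

/-- A union of sets of cardinality at most `c`, for `c` infinite. -/
theorem lift_mk_iUnion_le_max {ι : Type u} {α : Type v} (f : ι → Set α) {c : Cardinal.{v}}
    (hc : ℵ₀ ≤ c) (hf : ∀ i, #(f i) ≤ c) :
    lift.{u} #(⋃ i, f i) ≤ max (lift.{v} #ι) (lift.{u} c) := by
  refine mk_iUnion_le_sum_mk_lift.trans ((sum_le_sum _ (fun _ => c) hf).trans ?_)
  rw [sum_const]
  exact mul_le_max_of_aleph0_le_right (by simpa using hc)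

section Swindle

variable {R : Type*} [Ring R]

/-- Finitely supported functions into a product are pairs of finitely supported functions. -/
noncomputable def finsuppProdLinearEquiv (ι P Q : Type*) [AddCommGroup P] [Module R P]
    [AddCommGroup Q] [Module R Q] : (ι →₀ P × Q) ≃ₗ[R] (ι →₀ P) × (ι →₀ Q) :=
  LinearEquiv.ofLinearMap
    ((Finsupp.mapRange.linearMap (LinearMap.fst R P Q)).prod
      (Finsupp.mapRange.linearMap (LinearMap.snd R P Q)))
    ((Finsupp.mapRange.linearMap (LinearMap.inl R P Q)).coprod
      (Finsupp.mapRange.linearMap (LinearMap.inr R P Q)))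
    (by ext <;> simp) (by ext <;> simp)

/-- Prepending one term to a sequence of finite support. -/
noncomputable def prodFinsuppNatLinearEquiv (P : Type*) [AddCommGroup P] [Module R P] :
    (P × (ℕ →₀ P)) ≃ₗ[R] (ℕ →₀ P) :=
  ((LinearEquiv.prodComm R _ _).trans
    ((LinearEquiv.refl R _).prodCongr (Finsupp.uniqueLinearEquiv R P PUnit.unit.{1}).symm)).trans
    ((Finsupp.sumFinsuppLEquivProdFinsupp R).symm.trans
      (Finsupp.domLCongr Equiv.natSumPUnitEquivNat))

/-- The Eilenberg swindle. -/
theorem free_prod_finsupp_nat (P : Type*) [AddCommGroup P] [Module R P] [Module.Projective R P] :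
    Module.Free R (P × (ℕ →₀ P →₀ R)) := by
  obtain ⟨s, hs⟩ := Module.projective_def'.1 ‹Module.Projective R P›
  set π := Finsupp.linearCombination R (id : P → P)
  have hs' : ∀ p, π (s p) = p := fun p => LinearMap.congr_fun hs p
  let e : (P × LinearMap.ker π) ≃ₗ[R] (P →₀ R) :=
    LinearEquiv.ofBijective (s.coprod (LinearMap.ker π).subtype) <| by
      constructor
      · rw [injective_iff_map_eq_zero]
        rintro ⟨p, q, hq⟩ h
        have hp : p = 0 := by
          simpa [hs', LinearMap.mem_ker.1 hq] using congrArg π h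
        subst hp
        simpa using h
      · intro x
        exact ⟨(π x, ⟨x - s (π x), by simp [hs']⟩), by simp⟩
  let E := (Finsupp.mapRange.linearEquiv (α := ℕ) e).symm.trans (finsuppProdLinearEquiv ℕ P (LinearMap.ker π))
  exact Module.Free.of_equiv
    (((LinearEquiv.refl R P).prodCongr E).trans
      ((LinearEquiv.prodAssoc R P (ℕ →₀ P) (ℕ →₀ LinearMap.ker π)).symm.trans
        (((prodFinsuppNatLinearEquiv P).prodCongr (LinearEquiv.refl R _)).trans E.symm))).symm

end Swindle

section Closure

variable {R : Type u} [CommRing R] [IsDomain R] {I J : Type (max u v)}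

/-- The preimage of a coordinate submodule lies in a coordinate submodule of comparable size. -/
theorem exists_comap_supported_le (k : (J →₀ R) →ₗ[R] (I →₀ R)) (hk : Function.Injective k)
    (X : Set I) :
    ∃ Y : Set J, #Y ≤ max #X ℵ₀ ∧
      (Finsupp.supported R R X).comap k ≤ Finsupp.supported R R Y := by
  set W := (Finsupp.supported R R X).comap k
  obtain ⟨s, hs, hmax⟩ := exists_maximal_linearIndepOn R (fun w : W => (w : J →₀ R))
  have hcard : #s ≤ #X := by
    have hli : LinearIndependent R
        (fun w : s => (⟨k w.1.1, w.1.2⟩ : Finsupp.supported R R X)) := by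
      refine LinearIndependent.of_comp (Finsupp.supported R R X).subtype ?_
      exact hs.map' k (LinearMap.ker_eq_bot.2 hk)
    have h := hli.cardinal_le_rank
    rw [(Finsupp.supportedEquivFinsupp (M := R) (R := R) X).rank_eq, rank_finsupp_self,
      lift_id'.{u, v}] at h
    exact h
  refine ⟨⋃ w ∈ s, (w.1.support : Set J), ?_, ?_⟩
  · rw [Set.biUnion_eq_iUnion]
    have h := lift_mk_iUnion_le_max (fun w : s => (w.1.1.support : Set J)) le_rfl
      fun w => (Finset.finite_toSet _).lt_aleph0.le
    simp only [lift_id] at h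
    exact h.trans (max_le_max_right _ hcard)
  · have hspan : Submodule.span R ((fun w : W => (w : J →₀ R)) '' s) ≤
        Finsupp.supported R R (⋃ w ∈ s, (w.1.support : Set J)) := by
      rw [Submodule.span_le]
      rintro _ ⟨w, hw, rfl⟩
      exact (Finsupp.mem_supported R _).2
        (Set.subset_biUnion_of_mem (u := fun w : W => (w.1.support : Set J)) hw)
    intro y hy
    by_cases hys : (⟨y, hy⟩ : W) ∈ s
    · exact hspan (Submodule.subset_span ⟨_, hys, rfl⟩)
    · obtain ⟨a, ha, hay⟩ := hmax _ hys
      have := (Finsupp.mem_supported R _).1 (hspan hay)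
      rwa [Finsupp.support_smul_eq ha] at this

/-- Enlarging `X` so that a coordinate submodule fits between the two preimages. -/
theorem exists_superset_supported_le_comap (k : (J →₀ R) →ₗ[R] (I →₀ R)) (hk : Function.Injective k)
    (X : Set I) :
    ∃ (X' : Set I) (Y : Set J), X ⊆ X' ∧ #X' ≤ max #X ℵ₀ ∧
      (Finsupp.supported R R X).comap k ≤ Finsupp.supported R R Y ∧
      Finsupp.supported R R Y ≤ (Finsupp.supported R R X').comap k := by
  obtain ⟨Y, hY, hXY⟩ := exists_comap_supported_le.{u, v} k hk X
  refine ⟨X ∪ ⋃ j : Y, ((k (Finsupp.single j 1)).support : Set I), Y,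
    Set.subset_union_left, ?_, hXY, ?_⟩
  · refine (mk_union_le _ _).trans (add_le_of_le (le_max_right _ _) (le_max_left _ _) ?_)
    have h := lift_mk_iUnion_le_max
      (fun j : Y => ((k (Finsupp.single j.1 1)).support : Set I)) le_rfl
      fun w => (Finset.finite_toSet _).lt_aleph0.le
    simp only [lift_id] at h
    exact h.trans (max_le hY (le_max_right _ _))
  · rw [Finsupp.supported_eq_span_single, Submodule.span_le]
    rintro _ ⟨j, hj, rfl⟩
    exact (Finsupp.mem_supported R _).2 ((Set.subset_iUnion
      (fun j : Y => ((k (Finsupp.single j.1 1)).support : Set I)) ⟨j, hj⟩).trans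
      Set.subset_union_right)

/-- Every set of coordinates of the codomain is contained in one of comparable size whose
coordinate submodule pulls back to a coordinate submodule. -/
theorem exists_comap_supported_eq (k : (J →₀ R) →ₗ[R] (I →₀ R)) (hk : Function.Injective k)
    (X : Set I) :
    ∃ (X' : Set I) (Y : Set J), X ⊆ X' ∧ #X' ≤ max #X ℵ₀ ∧
      (Finsupp.supported R R X').comap k = Finsupp.supported R R Y := by
  choose T S hT hcard hTS hST using exists_superset_supported_le_comap.{u, v} k hk
  let A : ℕ → Set I := fun n => T^[n] X
  have hA : ∀ n, A (n + 1) = T (A n) := fun n => Function.iterate_succ_apply' T n X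
  have hmono : Monotone A := monotone_nat_of_le_succ fun n => (hA n).symm ▸ hT (A n)
  have hAcard : ∀ n, #(A n) ≤ max #X ℵ₀ := by
    intro n
    induction n with
    | zero => exact le_max_left _ _
    | succ n ih => exact hA n ▸ (hcard (A n)).trans (max_le ih (le_max_right _ _))
  refine ⟨⋃ n, A n, ⋃ n, S (A n), Set.subset_iUnion A 0, ?_, le_antisymm ?_ ?_⟩
  · simpa using lift_mk_iUnion_le_max A (le_max_right _ _) hAcard
  · intro y hy
    have hy' : ((k y).support : Set I) ⊆ ⋃ n, A n := (Finsupp.mem_supported R _).1 hy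
    obtain ⟨n, hn⟩ := hmono.directed_le.exists_mem_subset_of_finset_subset_biUnion hy'
    exact Finsupp.supported_mono (Set.subset_iUnion (fun n => S (A n)) n)
      (hTS (A n) ((Finsupp.mem_supported R _).2 hn))
  · rw [Finsupp.supported_iUnion, iSup_le_iff]
    refine fun n => (hST (A n)).trans (Submodule.comap_mono (Finsupp.supported_mono ?_))
    exact hA n ▸ Set.subset_iUnion A (n + 1)

end Closure

section Resolution

theorem pdLeOne_quotient_map {R : Type u} [CommRing R] {M : Type v} [AddCommGroup M] [Module R M]
    {F H : Type (max u v)} [AddCommGroup F] [Module R F] [AddCommGroup H] [Module R H]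
    {k : H →ₗ[R] F} {g : F →ₗ[R] M} (hg : Function.Surjective g) (hkg : Function.Exact k g)
    (A : Submodule R F) [Module.Projective R (F ⧸ A)] [Module.Projective R (H ⧸ A.comap k)] :
    PdLeOne R (M ⧸ A.map g) := by
  let q := A.mapQ (A.map g) g (Submodule.le_comap_map g A)
  let j := (A.comap k).mapQ A k le_rfl
  have hj : Function.Injective j := by
    rw [← LinearMap.ker_eq_bot, LinearMap.ker_eq_bot']
    intro x hx
    obtain ⟨x, rfl⟩ := Submodule.Quotient.mk_surjective _ x
    simpa [j, Submodule.Quotient.mk_eq_zero] using hx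
  have hjq : LinearMap.range j = LinearMap.ker q := by
    ext x
    obtain ⟨x, rfl⟩ := Submodule.Quotient.mk_surjective _ x
    constructor
    · rintro ⟨y, hy⟩
      obtain ⟨y, rfl⟩ := Submodule.Quotient.mk_surjective _ y
      rw [← hy]
      simp [j, q, hkg.apply_apply_eq_zero]
    · intro hx
      have hx' : g x ∈ A.map g := by
        simpa only [q, LinearMap.mem_ker, Submodule.mapQ_apply,
          Submodule.Quotient.mk_eq_zero] using hx
      obtain ⟨a, ha, hax⟩ := hx'
      obtain ⟨y, hy⟩ := (hkg (x - a)).1 (by rw [map_sub, hax, sub_self])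
      refine ⟨Submodule.Quotient.mk y, ?_⟩
      rw [Submodule.mapQ_apply, hy, Submodule.Quotient.eq]
      simpa using ha
  refine ⟨F ⧸ A, inferInstance, inferInstance, q, inferInstance, ?_, ?_⟩
  · intro x
    obtain ⟨x, rfl⟩ := Submodule.Quotient.mk_surjective _ x
    obtain ⟨y, rfl⟩ := hg x
    exact ⟨Submodule.Quotient.mk y, rfl⟩
  · exact Module.Projective.of_equiv
      ((LinearEquiv.ofInjective j hj).trans (LinearEquiv.ofEq _ _ hjq))

theorem projective_quotient_supported {R I : Type*} [CommRing R] (X : Set I) :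
    Module.Projective R ((I →₀ R) ⧸ Finsupp.supported R R X) := by
  have h : IsCompl (Finsupp.supported R R X) (Finsupp.supported R R Xᶜ) :=
    ⟨Finsupp.disjoint_supported_supported disjoint_compl_right,
      Finsupp.codisjoint_supported_supported isCompl_compl.codisjoint⟩
  exact Module.Projective.of_equiv ((Submodule.quotientEquivOfIsCompl _ _ h).trans
    (Finsupp.supportedEquivFinsupp (M := R) (R := R) Xᶜ)).symm

theorem PdLeOne.exists_finsupp {R : Type u} [CommRing R] {M : Type v} [AddCommGroup M] [Module R M]
    (hM : PdLeOne R M) :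
    ∃ (I J : Type (max u v)) (k : (J →₀ R) →ₗ[R] (I →₀ R)) (g : (I →₀ R) →ₗ[R] M),
      Function.Injective k ∧ Function.Surjective g ∧ Function.Exact k g := by
  obtain ⟨P, _, _, f, _, hf, _⟩ := hM
  let K := LinearMap.ker f
  let A := ℕ →₀ P →₀ R
  let B := ℕ →₀ K →₀ R
  have := free_prod_finsupp_nat (R := R) P
  have := free_prod_finsupp_nat (R := R) K
  have : Module.Free R (P × (A × B)) :=
    Module.Free.of_equiv (LinearEquiv.prodAssoc R P A B)
  have : Module.Free R (K × (A × B)) :=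
    Module.Free.of_equiv ((LinearEquiv.prodAssoc R K B A).trans
      ((LinearEquiv.refl R K).prodCongr (LinearEquiv.prodComm R B A)))
  let bF := (Module.Free.chooseBasis R (P × (A × B))).repr
  let bH := (Module.Free.chooseBasis R (K × (A × B))).repr
  let k₀ : K × (A × B) →ₗ[R] P × (A × B) := K.subtype.prodMap LinearMap.id
  let g₀ : P × (A × B) →ₗ[R] M := f ∘ₗ LinearMap.fst R P (A × B)
  have hk₀ : Function.Injective k₀ :=
    Function.Injective.prodMap K.injective_subtype Function.injective_id
  have hex : Function.Exact k₀ g₀ := by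
    rintro ⟨p, l⟩
    constructor
    · intro h
      exact ⟨(⟨p, h⟩, l), rfl⟩
    · rintro ⟨⟨x, l⟩, h⟩
      rw [← h]
      exact x.2
  refine ⟨_, _, bF.toLinearMap ∘ₗ k₀ ∘ₗ bH.symm.toLinearMap, g₀ ∘ₗ bF.symm.toLinearMap,
    ?_, ?_, ?_⟩
  · exact bF.injective.comp (hk₀.comp bH.symm.injective)
  · exact (hf.comp Prod.fst_surjective).comp bF.symm.surjective
  · intro x
    constructor
    · intro h
      obtain ⟨y, hy⟩ := (hex _).1 h
      exact ⟨bH y, by simp [hy]⟩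
    · rintro ⟨y, rfl⟩
      simpa using hex.apply_apply_eq_zero _

end Resolution

/-- every submodule is contained in a tight submodule with not many
more generators. -/
theorem statement8 (V : Type u) [CommRing V] [IsDomain V] [ValuationRing V]
    (M : Type v) [AddCommGroup M] [Module V M] (hM : PdLeOne V M)
    (N : Submodule V M) :
    ∃ Nstar : Submodule V M, N ≤ Nstar ∧ Tight V Nstar ∧
      gen V ↥Nstar ≤ max (gen V ↥N) Cardinal.aleph0 := by
  obtain ⟨I, J, k, g, hk, hg, hkg⟩ := hM.exists_finsupp
  obtain ⟨T, rfl, hTcard⟩ := exists_span_eq_mk_le_gen N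
  obtain ⟨c, hc⟩ := hg.hasRightInverse
  obtain ⟨X, Y, hX, hXcard, hXY⟩ :=
    exists_comap_supported_eq.{u, v} k hk (⋃ t : T, ((c t).support : Set I))
  refine ⟨(Finsupp.supported V V X).map g, ?_, ?_, ?_⟩
  · rw [Submodule.span_le]
    intro t ht
    refine ⟨c t, (Finsupp.mem_supported V _).2 (Set.Subset.trans ?_ hX), hc t⟩
    exact Set.subset_iUnion (fun t : T => ((c t).support : Set I)) ⟨t, ht⟩
  · have := projective_quotient_supported (R := V) X
    have : Module.Projective V ((J →₀ V) ⧸ (Finsupp.supported V V X).comap k) :=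
      hXY ▸ projective_quotient_supported Y
    exact pdLeOne_quotient_map hg hkg _
  · rw [Finsupp.supported_eq_span_single, Submodule.map_span, Set.image_image]
    refine (gen_span_le _).trans ?_
    have hT := lift_mk_iUnion_le_max (fun t : T => ((c t).support : Set I)) le_rfl
      fun t => (Finset.finite_toSet _).lt_aleph0.le
    have h := mk_image_le_lift (s := X) (f := fun i => g (Finsupp.single i 1))
    rw [← lift_le.{max u v}]
    refine (h.trans (lift_le.2 hXcard)).trans ?_
    rw [lift_aleph0] at hT
    rw [lift_max, lift_max, lift_aleph0, lift_aleph0]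
    exact max_le (hT.trans (max_le_max_right _ (lift_le.2 hTcard))) (le_max_right _ _)
end

section
/- Let V be a Matlis valuation domain, i.e., a valuation domain whose field of fractions Q satisfies pd_V Q ≤ 1. Then a V-module D with pd D ≤ 1 is divisible if and only if D is isomorphic to a direct sum of copies of Q and copies of K = Q/V. -/
universe u v

open Pointwise

/-- `D` is a divisible module. -/
def Divisible (V : Type u) [CommRing V] (D : Type*) [AddCommGroup D]
    [Module V D] : Prop :=
  ∀ r : V, r ≠ 0 → ∀ d : D, ∃ e : D, r • e = d

section FreePresentation

variable {R : Type*} [CommRing R]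

/-- The Eilenberg swindle: a projective module is absorbed by a sufficiently large free module. -/
theorem exists_prod_finsupp_equiv (P : Type*) [AddCommGroup P] [Module R P]
    [Module.Projective R P] :
    Nonempty ((P × (ℕ →₀ (P →₀ R))) ≃ₗ[R] (ℕ →₀ (P →₀ R))) := by
  obtain ⟨i, hi⟩ := Module.projective_def'.1 ‹Module.Projective R P›
  set s := Finsupp.linearCombination R (id : P → P)
  have hs (x : P) : s (i x) = x := LinearMap.congr_fun hi x
  let e : (P →₀ R) ≃ₗ[R] P × LinearMap.ker s :=
    LinearEquiv.ofLinearMap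
      (s.prod ((LinearMap.id - i ∘ₗ s).codRestrict _ fun x => by simp [hs]))
      (i.coprod (LinearMap.ker s).subtype)
      (by ext x <;> simp [hs]) (by ext x; simp)
  let split : (ℕ →₀ P × LinearMap.ker s) ≃ₗ[R] (ℕ →₀ P) × (ℕ →₀ LinearMap.ker s) :=
    LinearEquiv.ofLinearMap
      ((Finsupp.mapRange.linearMap (LinearMap.fst R _ _)).prod
        (Finsupp.mapRange.linearMap (LinearMap.snd R _ _)))
      ((Finsupp.mapRange.linearMap (LinearMap.inl R _ _)).coprod
        (Finsupp.mapRange.linearMap (LinearMap.inr R _ _)))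
      (by ext <;> simp [Finsupp.single_apply]) (by ext <;> simp [Finsupp.single_apply])
  let g : (ℕ →₀ (P →₀ R)) ≃ₗ[R] (ℕ →₀ P) × (ℕ →₀ LinearMap.ker s) :=
    Finsupp.mapRange.linearEquiv e ≪≫ₗ split
  let shift : (P × (ℕ →₀ P)) ≃ₗ[R] (ℕ →₀ P) :=
    ((Finsupp.uniqueLinearEquiv R P ()).symm.prodCongr (LinearEquiv.refl R _)) ≪≫ₗ
      (Finsupp.sumFinsuppLEquivProdFinsupp R).symm ≪≫ₗ
      Finsupp.domLCongr ((Equiv.sumComm _ _).trans Equiv.natSumPUnitEquivNat)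
  exact ⟨(LinearEquiv.refl R P).prodCongr g ≪≫ₗ (LinearEquiv.prodAssoc R _ _ _).symm ≪≫ₗ
    shift.prodCongr (LinearEquiv.refl R _) ≪≫ₗ g.symm⟩

theorem PdLeOne.exists_free_presentation {V : Type u} [CommRing V] {M : Type v} [AddCommGroup M]
    [Module V M] (h : PdLeOne V M) :
    ∃ (I : Type (max u v)) (f : (I →₀ V) →ₗ[V] M),
      Function.Surjective f ∧ Module.Free V (LinearMap.ker f) := by
  obtain ⟨P, _, _, f, hP, hf, hK⟩ := h
  let A := ℕ →₀ (P →₀ V)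
  let B := ℕ →₀ (LinearMap.ker f →₀ V)
  obtain ⟨eP⟩ := exists_prod_finsupp_equiv (R := V) P
  obtain ⟨eK⟩ := exists_prod_finsupp_equiv (R := V) (LinearMap.ker f)
  have hfree : Module.Free V (P × (A × B)) :=
    .of_equiv ((LinearEquiv.prodAssoc V P A B).symm ≪≫ₗ
      eP.prodCongr (LinearEquiv.refl V B)).symm
  obtain ⟨I, b⟩ := hfree.exists_basis
  let f' : (P × (A × B)) →ₗ[V] M := f ∘ₗ LinearMap.fst V _ _
  let eker : (LinearMap.ker f × (A × B)) ≃ₗ[V] LinearMap.ker f' :=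
    { toFun x := ⟨((x.1 : P), x.2), x.1.2⟩
      invFun x := (⟨x.1.1, x.2⟩, x.1.2)
      map_add' _ _ := rfl
      map_smul' _ _ := rfl
      left_inv _ := rfl
      right_inv _ := rfl }
  have hker : Module.Free V (LinearMap.ker f') :=
    .of_equiv ((eK.prodCongr (LinearEquiv.refl V A)).symm ≪≫ₗ
      LinearEquiv.prodAssoc V _ B A ≪≫ₗ
      (LinearEquiv.refl V _).prodCongr (LinearEquiv.prodComm V B A) ≪≫ₗ eker)
  let ef : LinearMap.ker f' ≃ₗ[V] LinearMap.ker (f' ∘ₗ b.repr.symm.toLinearMap) :=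
    b.repr.ofSubmodules _ _ (by
      ext x
      simp [Submodule.mem_map_equiv])
  exact ⟨_, f' ∘ₗ b.repr.symm.toLinearMap,
    (hf.comp Prod.fst_surjective).comp b.repr.symm.surjective, .of_equiv ef⟩

end FreePresentation

section Rank

variable {R M N : Type*} [CommRing R] [IsDomain R] [AddCommGroup M] [Module R M]
  [AddCommGroup N] [Module R N]

theorem exists_set_smul_mem_span_sup_ker (φ : M →ₗ[R] N) :
    ∃ s : Set M, LinearIndependent R (fun x : s => φ x) ∧
      ∀ m, ∃ a : R, a ≠ 0 ∧ a • m ∈ Submodule.span R s ⊔ LinearMap.ker φ := by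
  obtain ⟨s, hs, hmax⟩ := exists_maximal_linearIndepOn R (φ : M → N)
  refine ⟨s, hs, fun m => ?_⟩
  by_cases hm : m ∈ s
  · exact ⟨1, one_ne_zero, by
      simp [Submodule.mem_sup_left (Submodule.subset_span hm)]⟩
  · obtain ⟨a, ha, h⟩ := hmax m hm
    refine ⟨a, ha, ?_⟩
    rw [← map_smul, ← Submodule.map_span] at h
    rw [← Submodule.comap_map_eq]
    exact h

theorem exists_finite_smul_mem_span_sup_ker [Module.Finite R N] (φ : M →ₗ[R] N) :
    ∃ s : Set M, s.Finite ∧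
      ∀ m, ∃ a : R, a ≠ 0 ∧ a • m ∈ Submodule.span R s ⊔ LinearMap.ker φ := by
  obtain ⟨s, hs, h⟩ := exists_set_smul_mem_span_sup_ker φ
  refine ⟨s, ?_, h⟩
  rw [← Set.finite_coe_iff]
  exact hs.finite

theorem exists_countable_smul_mem_span_sup_ker {X : Type*} [Countable X] (φ : M →ₗ[R] (X →₀ R)) :
    ∃ s : Set M, s.Countable ∧
      ∀ m, ∃ a : R, a ≠ 0 ∧ a • m ∈ Submodule.span R s ⊔ LinearMap.ker φ := by
  obtain ⟨s, hs, h⟩ := exists_set_smul_mem_span_sup_ker φ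
  refine ⟨s, ?_, h⟩
  have h1 := hs.cardinal_lift_le_rank
  rw [rank_finsupp_self] at h1
  rw [← Set.countable_coe_iff, ← Cardinal.mk_le_aleph0_iff]
  rw [← Cardinal.lift_le_aleph0]
  refine h1.trans ?_
  simp

end Rank

section AdaptedSets

variable {R I J : Type*} [CommRing R] (κ : (J →₀ R) →ₗ[R] (I →₀ R))

/-- The submodule spanned by the basis vectors whose image under `κ` is supported in `S`. -/
def supportedPreimage (S : Set I) : Submodule R (J →₀ R) :=
  Finsupp.supported R R {j | κ (Finsupp.single j 1) ∈ Finsupp.supported R R S}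

/-- A set `S` of coordinates is adapted to a map `κ` of free modules if every element whose image
is supported in `S` is a combination of basis vectors with the same property. -/
def Adapted (S : Set I) : Prop :=
  (Finsupp.supported R R S).comap κ ≤ supportedPreimage κ S

theorem supportedPreimage_mono {S S' : Set I} (h : S ⊆ S') :
    supportedPreimage κ S ≤ supportedPreimage κ S' :=
  Finsupp.supported_mono fun j (hj : κ (Finsupp.single j 1) ∈ Finsupp.supported R R S) =>
    Finsupp.supported_mono h hj

theorem map_mem_supported_of_mem_supportedPreimage {S : Set I} {x : J →₀ R}
    (hx : x ∈ supportedPreimage κ S) : κ x ∈ Finsupp.supported R R S := by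
  rw [supportedPreimage, Finsupp.supported_eq_span_single] at hx
  have : Submodule.span R ((fun j => Finsupp.single j (1 : R)) ''
      {j | κ (Finsupp.single j 1) ∈ Finsupp.supported R R S}) ≤
      (Finsupp.supported R R S).comap κ := by
    rw [Submodule.span_le]
    rintro _ ⟨j, hj, rfl⟩
    exact hj
  exact this hx

variable {κ}

theorem adapted_empty (hκ : Function.Injective κ) : Adapted κ (∅ : Set I) := by
  intro h hh
  have : κ h = 0 := by simpa using hh
  simp [(map_eq_zero_iff κ hκ).1 this]

theorem adapted_iUnion_of_directed {ι : Type*} [Nonempty ι] {S : ι → Set I}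
    (hd : Directed (· ⊆ ·) S)
    (hS : ∀ i, ∃ k, (Finsupp.supported R R (S i)).comap κ ≤ supportedPreimage κ (S k)) :
    Adapted κ (⋃ i, S i) := by
  intro h hh
  rw [Submodule.mem_comap, Finsupp.mem_supported] at hh
  obtain ⟨i, hi⟩ := hd.exists_mem_subset_of_finset_subset_biUnion hh
  obtain ⟨k, hk⟩ := hS i
  exact supportedPreimage_mono κ (Set.subset_iUnion S k) (hk hi)

variable [IsDomain R]

theorem Finsupp.mem_supported_of_smul_mem {T : Set J} {x : J →₀ R} {a : R} (ha : a ≠ 0)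
    (h : a • x ∈ Finsupp.supported R R T) : x ∈ Finsupp.supported R R T := by
  rw [Finsupp.mem_supported] at h ⊢
  rwa [Finsupp.support_smul_eq ha] at h

theorem Adapted.exists_countable_step {S : Set I} (hS : Adapted κ S) (σ : I → Set I)
    (hσ : ∀ i, (σ i).Countable) {X : Set I} (hX : X.Countable) :
    ∃ Y : Set I, X ⊆ Y ∧ Y.Countable ∧ (∀ i ∈ X, σ i ⊆ Y) ∧
      (Finsupp.supported R R (S ∪ X)).comap κ ≤ supportedPreimage κ (S ∪ Y) := by
  classical
  have := hX.to_subtype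
  let M : Submodule R (J →₀ R) := (Finsupp.supported R R (S ∪ X)).comap κ
  let φ : M →ₗ[R] (X →₀ R) := Finsupp.lsubtypeDomain X ∘ₗ κ ∘ₗ M.subtype
  obtain ⟨s, hs, hmax⟩ := exists_countable_smul_mem_span_sup_ker (M := M) φ
  let Y := X ∪ (⋃ i ∈ X, σ i) ∪
    ⋃ m ∈ s, ⋃ j ∈ m.1.support, ((κ (Finsupp.single j 1)).support : Set I)
  have hXY : X ⊆ Y := fun x hx => .inl (.inl hx)
  refine ⟨Y, hXY, ?_, fun i hi x hx => .inl (.inr (Set.mem_biUnion hi hx)), ?_⟩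
  · refine (hX.union (hX.biUnion fun i _ => hσ i)).union (hs.biUnion fun m _ => ?_)
    exact (Finset.countable_toSet _).biUnion fun j _ => Finset.countable_toSet _
  · intro h hh
    obtain ⟨a, ha, hmem⟩ := hmax ⟨h, hh⟩
    refine Finsupp.mem_supported_of_smul_mem ha ?_
    have key : Submodule.span R s ⊔ LinearMap.ker φ ≤
        (supportedPreimage κ (S ∪ Y)).comap M.subtype := by
      refine sup_le (Submodule.span_le.2 fun m hm => ?_) fun m hm => ?_
      · refine (Finsupp.mem_supported R _).2 fun j hj => (Finsupp.mem_supported R _).2 fun i hi =>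
          .inr (.inr (Set.mem_biUnion hm (Set.mem_biUnion hj hi)))
      · have h0 : κ m.1 ∈ Finsupp.supported R R S := by
          rw [Finsupp.mem_supported]
          intro i hi
          by_contra hiS
          have hiX : i ∈ X := (((Finsupp.mem_supported R _).1 m.2) hi).resolve_left hiS
          have := DFunLike.congr_fun (LinearMap.mem_ker.1 hm) ⟨i, hiX⟩
          exact (Finsupp.mem_support_iff.1 hi) this
        exact supportedPreimage_mono κ Set.subset_union_left (hS h0)
    exact key hmem

/-- Adapted sets can be enlarged by a countable set that contains a given countable set and is
closed under a given countably branching relation. -/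
theorem Adapted.exists_countable_extension {S : Set I} (hS : Adapted κ S) (σ : I → Set I)
    (hσ : ∀ i, (σ i).Countable) {X : Set I} (hX : X.Countable) :
    ∃ Y : Set I, X ⊆ Y ∧ Y.Countable ∧ (∀ i ∈ Y, σ i ⊆ Y) ∧ Adapted κ (S ∪ Y) := by
  choose! next h1 h2 h3 h4 using fun (X : Set I) (hX : X.Countable) =>
    hS.exists_countable_step σ hσ hX
  let Z : ℕ → Set I := fun n => next^[n] X
  have hZ (n : ℕ) : Z (n + 1) = next (Z n) := Function.iterate_succ_apply' _ _ _
  have hc (n : ℕ) : (Z n).Countable := by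
    induction n with
    | zero => exact hX
    | succ n ih => rw [hZ]; exact h2 _ ih
  have hmono : Monotone Z := monotone_nat_of_le_succ fun n => by rw [hZ]; exact h1 _ (hc n)
  refine ⟨⋃ n, Z n, Set.subset_iUnion Z 0, Set.countable_iUnion hc, ?_, ?_⟩
  · intro i hi
    obtain ⟨n, hn⟩ := Set.mem_iUnion.1 hi
    refine (h3 _ (hc n) i hn).trans ?_
    rw [← hZ]
    exact Set.subset_iUnion Z _
  · rw [Set.union_iUnion]
    refine adapted_iUnion_of_directed
      (directed_of_isDirected_le fun m n h => Set.union_subset_union_right S (hmono h)) fun n =>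
      ⟨n + 1, ?_⟩
    rw [hZ]
    exact h4 _ (hc n)

end AdaptedSets

section Coherent

variable {R M N : Type*} [CommRing R] [AddCommGroup M] [Module R M] [AddCommGroup N] [Module R N]

/-- Every finite family of elements of `M` has a finitely generated module of relations. -/
def FiniteRelations (R : Type*) [CommRing R] (M : Type*) [AddCommGroup M] [Module R M] : Prop :=
  ∀ (n : ℕ) (g : (Fin n → R) →ₗ[R] M), (LinearMap.ker g).FG

theorem FiniteRelations.fg_ker [Nontrivial R] (h : FiniteRelations R M) {F : Type*}
    [AddCommGroup F] [Module R F]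
    [Module.Finite R F] [Module.Free R F] (g : F →ₗ[R] M) : (LinearMap.ker g).FG := by
  let e := (Module.finBasis R F).equivFun
  have := (h _ (g ∘ₗ e.symm.toLinearMap)).map e.symm.toLinearMap
  rwa [LinearMap.ker_comp, Submodule.map_comap_eq_of_surjective e.symm.surjective] at this

variable [IsDomain R] [ValuationRing R]

theorem fg_ker_of_isTorsionFree [Module.IsTorsionFree R N] [Module.Finite R M] (g : M →ₗ[R] N) :
    (LinearMap.ker g).FG := by
  have : Module.Flat R (LinearMap.range g) := by
    rw [Module.Flat.flat_iff_torsion_eq_bot_of_isBezout,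
      ← Submodule.isTorsionFree_iff_torsion_eq_bot]
    infer_instance
  have : Module.Free R (LinearMap.range g) := Module.free_of_flat_of_isLocalRing
  have : Module.FinitePresentation R (LinearMap.range g) :=
    Module.finitePresentation_of_projective R _
  have := Module.FinitePresentation.fg_ker g.rangeRestrict g.surjective_rangeRestrict
  rwa [LinearMap.ker_rangeRestrict] at this

/-- A submodule has bounded torsion in a finitely generated module over a valuation domain. -/
theorem exists_smul_mem_of_smul_mem [Module.Finite R M] (P : Submodule R M) :
    ∃ t : R, t ≠ 0 ∧ ∀ (m : M) (s : R), s ≠ 0 → s • m ∈ P → t • m ∈ P := by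
  let T := Submodule.torsion R (M ⧸ P)
  have hfg : (LinearMap.ker (T.mkQ ∘ₗ P.mkQ)).FG := fg_ker_of_isTorsionFree _
  have key (m : M) : m ∈ LinearMap.ker (T.mkQ ∘ₗ P.mkQ) ↔ ∃ s : R, s ≠ 0 ∧ s • m ∈ P := by
    simp only [LinearMap.mem_ker, LinearMap.comp_apply, Submodule.mkQ_apply,
      Submodule.Quotient.mk_eq_zero, T, Submodule.mem_torsion_iff]
    constructor
    · rintro ⟨a, ha⟩
      refine ⟨a, nonZeroDivisors.ne_zero a.2, ?_⟩
      rw [← Submodule.Quotient.mk_eq_zero]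
      exact ha
    · rintro ⟨s, hs, h⟩
      refine ⟨⟨s, mem_nonZeroDivisors_of_ne_zero hs⟩, ?_⟩
      rw [← Submodule.Quotient.mk_eq_zero] at h
      exact h
  obtain ⟨G, hG⟩ := hfg
  have hG' : ∀ g ∈ G, ∃ s : R, s ≠ 0 ∧ s • g ∈ P := fun g hg =>
    (key g).1 (hG ▸ Submodule.subset_span hg)
  choose! s hs0 hs using hG'
  refine ⟨∏ g ∈ G, s g, Finset.prod_ne_zero_iff.2 hs0, fun m a ha hm => ?_⟩
  have hm' : m ∈ Submodule.span R (G : Set M) := hG ▸ (key m).2 ⟨a, ha, hm⟩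
  have : Submodule.span R (G : Set M) ≤ P.comap (LinearMap.lsmul R M (∏ g ∈ G, s g)) := by
    rw [Submodule.span_le]
    intro g hg
    obtain ⟨d, hd⟩ := Finset.dvd_prod_of_mem s hg
    change (∏ g ∈ G, s g) • g ∈ P
    rw [hd, mul_comm, mul_smul]
    exact P.smul_mem _ (hs g hg)
  exact this hm'

end Coherent

section Presentation

variable {R I J D : Type*} [CommRing R] [AddCommGroup D] [Module R D]

theorem map_fst_ker_coprod {M M' N : Type*} [AddCommGroup M] [Module R M] [AddCommGroup M']
    [Module R M'] [AddCommGroup N] [Module R N] (p : M →ₗ[R] N) (q : M' →ₗ[R] N) :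
    (LinearMap.ker (p.coprod q)).map (LinearMap.fst R M M') = (LinearMap.range q).comap p := by
  ext v
  constructor
  · rintro ⟨⟨v, w⟩, h, rfl⟩
    refine ⟨-w, ?_⟩
    have h' : p v + q w = 0 := h
    simp [eq_neg_of_add_eq_zero_left h']
  · rintro ⟨w, hw⟩
    exact ⟨(v, -w), by simp [hw], rfl⟩

theorem fg_comap_map_of_isTorsionFree [IsDomain R] [ValuationRing R] {M M' N : Type*}
    [AddCommGroup M] [Module R M] [AddCommGroup M'] [Module R M'] [AddCommGroup N] [Module R N]
    [Module.Finite R M] [Module.IsTorsionFree R N] (p : M →ₗ[R] N) (q : M' →ₗ[R] N)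
    {L : Submodule R M'} (hL : L.FG) : ((L.map q).comap p).FG := by
  have := Module.Finite.iff_fg.2 hL
  rw [← LinearMap.range_domRestrict, ← map_fst_ker_coprod]
  exact (fg_ker_of_isTorsionFree _).map _

variable [IsDomain R]

instance isTorsionFree_quotient_supported (S : Set I) :
    Module.IsTorsionFree R ((I →₀ R) ⧸ Finsupp.supported R R S) := by
  refine .of_smul_eq_zero fun r x h => ?_
  induction x using Submodule.Quotient.induction_on with
  | H x =>
    rw [← Submodule.Quotient.mk_smul, Submodule.Quotient.mk_eq_zero] at h
    rw [Submodule.Quotient.mk_eq_zero, or_iff_not_imp_left]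
    exact fun hr => Finsupp.mem_supported_of_smul_mem hr h

/-- Over a valuation domain, quotients by images of adapted sets in a module of projective
dimension at most one have finitely generated modules of relations. -/
theorem Adapted.finiteRelations_quotient [ValuationRing R] {κ : (J →₀ R) →ₗ[R] (I →₀ R)}
    {f : (I →₀ R) →ₗ[R] D} (hf : Function.Surjective f)
    (hκf : LinearMap.range κ = LinearMap.ker f) {S : Set I} (hS : Adapted κ S) :
    FiniteRelations R (D ⧸ (Finsupp.supported R R S).map f) := by
  classical
  set F := Finsupp.supported R R S
  intro n g
  obtain ⟨g', hg'⟩ := Module.projective_lifting_property ((F.map f).mkQ ∘ₗ f) g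
    ((Submodule.mkQ_surjective _).comp hf)
  have hker (v : Fin n → R) : v ∈ LinearMap.ker (((F.map f).mkQ ∘ₗ f) ∘ₗ g') ↔
      ∃ h, g' v - κ h ∈ F := by
    simp only [LinearMap.mem_ker, LinearMap.comp_apply, Submodule.mkQ_apply,
      Submodule.Quotient.mk_eq_zero, Submodule.mem_map]
    constructor
    · rintro ⟨y, hy, hyv⟩
      have : g' v - y ∈ LinearMap.range κ := by simp [hκf, hyv]
      obtain ⟨h, hh⟩ := this
      exact ⟨h, by simpa [hh] using hy⟩
    · rintro ⟨h, hh⟩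
      refine ⟨_, hh, ?_⟩
      have : κ h ∈ LinearMap.ker f := hκf ▸ LinearMap.mem_range_self κ h
      simp [LinearMap.mem_ker.1 this]
  set P := LinearMap.ker (((F.map f).mkQ ∘ₗ f) ∘ₗ g')
  choose! h hh using fun v => (hker v).1
  obtain ⟨s, hs, hmax⟩ := exists_finite_smul_mem_span_sup_ker (M := P) P.subtype
  let T : Set J := ⋃ v ∈ s, ((h v).support : Set J)
  have hT : T.Finite := hs.biUnion fun v _ => Finset.finite_toSet _
  have hTfg : (Finsupp.supported R R T).FG := by
    rw [Finsupp.supported_eq_span_single]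
    exact Submodule.fg_span (hT.image _)
  have hspan : Submodule.span R s ⊔ LinearMap.ker P.subtype ≤
      ((F ⊔ (Finsupp.supported R R T).map κ).comap g').comap P.subtype := by
    rw [Submodule.ker_subtype, sup_bot_eq, Submodule.span_le]
    intro v hv
    refine Submodule.mem_sup.2 ⟨_, hh v v.2, κ (h v), ⟨_, ?_, rfl⟩, by simp⟩
    exact (Finsupp.mem_supported R _).2 fun j hj => Set.mem_biUnion hv hj
  have hP : P = ((Finsupp.supported R R T).map (F.mkQ ∘ₗ κ)).comap
      (F.mkQ ∘ₗ g') := by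
    ext v
    constructor
    · intro hv
      obtain ⟨a, ha, hav⟩ := hmax ⟨v, hv⟩
      obtain ⟨y, hy, _, ⟨k, hk, rfl⟩, hyk⟩ := Submodule.mem_sup.1 (hspan hav)
      have h1 : κ (a • h v - k) ∈ F := by
        have : κ (a • h v - k) = y - a • (g' v - κ (h v)) := by
          have h2 : y + κ k = a • g' v := by simpa using hyk
          rw [smul_sub, ← h2, map_sub, map_smul]
          abel
        rw [this]
        exact sub_mem hy (F.smul_mem a (hh v hv))
      have h2 : a • h v ∈ supportedPreimage κ S ⊔ Finsupp.supported R R T :=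
        Submodule.mem_sup.2 ⟨_, hS h1, k, hk, by simp⟩
      rw [supportedPreimage, ← Finsupp.supported_union] at h2
      have h3 := Finsupp.mem_supported_of_smul_mem ha h2
      rw [Finsupp.supported_union] at h3
      obtain ⟨p, hp, q, hq, hpq⟩ := Submodule.mem_sup.1 h3
      refine ⟨q, hq, ?_⟩
      have h4 : g' v - κ q ∈ F := by
        have : g' v - κ q = (g' v - κ (h v)) + κ p := by
          rw [← hpq, map_add]
          abel
        rw [this]
        exact add_mem (hh v hv) (map_mem_supported_of_mem_supportedPreimage κ hp)
      exact ((Submodule.Quotient.eq F).2 h4).symm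
    · rintro ⟨q, -, hq⟩
      exact (hker v).2 ⟨q, (Submodule.Quotient.eq F).1 hq.symm⟩
  rw [← hg']
  change P.FG
  rw [hP]
  exact fg_comap_map_of_isTorsionFree _ _ hTfg

theorem FiniteRelations.fg_comap_sup_span {A : Submodule R D} (hA : FiniteRelations R (D ⧸ A))
    {n : ℕ} (g : (Fin n → R) →ₗ[R] D) (x : D) : ((A ⊔ R ∙ x).comap g).FG := by
  have h := (hA.fg_ker ((A.mkQ ∘ₗ g).coprod (A.mkQ ∘ₗ LinearMap.toSpanSingleton R D x))).map
    (LinearMap.fst R _ _)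
  rwa [map_fst_ker_coprod, LinearMap.range_comp, LinearMap.range_toSpanSingleton,
    Submodule.comap_comp, Submodule.comap_map_mkQ] at h

end Presentation

section Divisible

variable {R I D : Type*} [CommRing R] [AddCommGroup D] [Module R D]

theorem PdLeOne.exists_free_resolution {V : Type u} [CommRing V] {M : Type v} [AddCommGroup M]
    [Module V M] (h : PdLeOne V M) :
    ∃ (I J : Type (max u v)) (f : (I →₀ V) →ₗ[V] M) (κ : (J →₀ V) →ₗ[V] (I →₀ V)),
      Function.Surjective f ∧ Function.Injective κ ∧ LinearMap.range κ = LinearMap.ker f := by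
  obtain ⟨I, f, hf, hfree⟩ := h.exists_free_presentation
  obtain ⟨J, b⟩ := hfree.exists_basis
  refine ⟨I, _, f, (LinearMap.ker f).subtype ∘ₗ b.repr.symm.toLinearMap, hf, ?_, ?_⟩
  · exact Subtype.val_injective.comp b.repr.symm.injective
  · rw [LinearMap.range_comp, LinearEquiv.range, Submodule.map_top, Submodule.range_subtype]

/-- A submodule is divisible if nonzero scalars act surjectively on it. -/
def IsDivisibleSubmodule (A : Submodule R D) : Prop :=
  ∀ r : R, r ≠ 0 → ∀ a ∈ A, ∃ b ∈ A, r • b = a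

theorem isDivisibleSubmodule_iff {A : Submodule R D} :
    IsDivisibleSubmodule A ↔
      ∀ r : R, r ≠ 0 → A ≤ A.map (LinearMap.lsmul R D r) := Iff.rfl

theorem isDivisibleSubmodule_sSup {𝒜 : Set (Submodule R D)}
    (h : ∀ A ∈ 𝒜, IsDivisibleSubmodule A) : IsDivisibleSubmodule (sSup 𝒜) := by
  simp only [isDivisibleSubmodule_iff] at *
  exact fun r hr => sSup_le fun A hA => (h A hA r hr).trans (Submodule.map_mono (le_sSup hA))

theorem le_map_lsmul_of_forall_single {f : (I →₀ R) →ₗ[R] D} {S : Set I} {r : R}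
    (h : ∀ i ∈ S, ∃ b ∈ (Finsupp.supported R R S).map f, r • b = f (Finsupp.single i 1)) :
    (Finsupp.supported R R S).map f ≤
      ((Finsupp.supported R R S).map f).map (LinearMap.lsmul R D r) := by
  refine (?_ : _ ≤ _).trans' ((congrArg (Submodule.map f)
    (Finsupp.supported_eq_span_single R S)).trans (Submodule.map_span f _)).le
  rw [Submodule.span_le]
  rintro _ ⟨_, ⟨i, hi, rfl⟩, rfl⟩
  exact h i hi

end Divisible

section FractionField

variable {V : Type*} [CommRing V] [IsDomain V]

theorem exists_smul_eq_algebraMap (q : FractionRing V) :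
    ∃ s a : V, s ≠ 0 ∧ s • q = algebraMap V _ a := by
  obtain ⟨⟨a, s⟩, h⟩ := IsLocalization.surj (nonZeroDivisors V) q
  exact ⟨s, a, nonZeroDivisors.ne_zero s.2, by rw [Algebra.smul_def, mul_comm, h]⟩

variable [ValuationRing V]

theorem exists_smul_eq_or_smul_eq (x y : FractionRing V) :
    (∃ c : V, c • x = y) ∨ ∃ c : V, c • y = x := by
  by_cases hx : x = 0
  · exact .inr ⟨0, by simp [hx]⟩
  by_cases hy : y = 0
  · exact .inl ⟨0, by simp [hy]⟩
  obtain ⟨c, hc⟩ | ⟨c, hc⟩ := ValuationRing.isInteger_or_isInteger V (x * y⁻¹)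
  · exact .inr ⟨c, by rw [Algebra.smul_def, hc]; field_simp⟩
  · exact .inl ⟨c, by rw [Algebra.smul_def, hc]; field_simp⟩

theorem exists_ker_eq_span_singleton {M : Type*} [AddCommGroup M] [Module V M]
    (h : FiniteRelations V M) (x : M) : ∃ r : V, ∀ a : V, a • x = 0 ↔ r ∣ a := by
  have := IsBezout.isPrincipal_of_FG _ (h.fg_ker (LinearMap.toSpanSingleton V M x))
  obtain ⟨r, hr⟩ := this
  refine ⟨r, fun a => ?_⟩
  rw [← LinearMap.toSpanSingleton_apply, ← LinearMap.mem_ker, hr]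
  exact Ideal.mem_span_singleton

theorem eq_top_of_finiteRelations_quotient {A : Submodule V (FractionRing V)} (h1 : 1 ∈ A) {p : V}
    (hp : ¬ IsUnit p) (hpA : A ≤ A.map (LinearMap.lsmul V _ p))
    (hA : FiniteRelations V (FractionRing V ⧸ A)) : A = ⊤ := by
  rw [eq_top_iff]
  intro q _
  by_contra hq
  obtain ⟨r, hr⟩ := exists_ker_eq_span_singleton hA (A.mkQ q)
  have hr (a : V) : a • q ∈ A ↔ r ∣ a := by
    rw [← hr, ← map_smul, Submodule.mkQ_apply, Submodule.Quotient.mk_eq_zero]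
  have hq0 : q ≠ 0 := by
    rintro rfl
    exact hq A.zero_mem
  have hr0 : r ≠ 0 := by
    rintro rfl
    obtain ⟨s, a, hs, h⟩ := exists_smul_eq_algebraMap q
    refine hs (zero_dvd_iff.1 ((hr s).1 ?_))
    rw [h, Algebra.algebraMap_eq_smul_one]
    exact A.smul_mem a h1
  obtain ⟨b, hb, hbq⟩ := hpA ((hr r).2 dvd_rfl)
  obtain ⟨c, hc⟩ | ⟨c, hc⟩ := exists_smul_eq_or_smul_eq b q
  · exact hq (hc ▸ A.smul_mem c hb)
  · rw [← hc] at hb hbq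
    obtain ⟨d, rfl⟩ := (hr c).1 hb
    have h : (p * (r * d)) • q = r • q := by rw [mul_smul]; exact hbq
    have h' : p * (r * d) = r := smul_left_injective V hq0 h
    have h'' : p * d = 1 := mul_left_cancel₀ hr0 (by linear_combination h')
    exact hp (IsUnit.of_mul_eq_one _ h'')

end FractionField

/-- The fraction field of a Matlis valuation domain is countably generated. -/
theorem exists_cofinal_sequence {V : Type u} [CommRing V] [IsDomain V] [ValuationRing V]
    (hMatlis : PdLeOne V (FractionRing V)) :
    ∃ u : ℕ → V, (∀ n, u n ≠ 0) ∧ (∀ n, u n ∣ u (n + 1)) ∧ ∀ s ≠ 0, ∃ n, s ∣ u n := by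
  by_cases hV : ∀ p : V, p ≠ 0 → IsUnit p
  · exact ⟨fun _ => 1, fun _ => one_ne_zero, fun _ => dvd_rfl, fun s hs => ⟨0, (hV s hs).dvd⟩⟩
  push Not at hV
  obtain ⟨p, hp0, hp⟩ := hV
  obtain ⟨I, J, f, κ, hf, hκ, hκf⟩ := hMatlis.exists_free_resolution
  choose lift hlift using hf
  obtain ⟨S, hXS, hSc, hσS, hS⟩ := (adapted_empty hκ).exists_countable_extension
    (fun i => ((lift ((algebraMap V _ p)⁻¹ * f (Finsupp.single i 1))).support : Set I))
    (fun i => Finset.countable_toSet _) (Finset.countable_toSet (lift 1).support)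
  rw [Set.empty_union] at hS
  have hp0' : algebraMap V (FractionRing V) p ≠ 0 := by simpa using hp0
  have htop := eq_top_of_finiteRelations_quotient (A := (Finsupp.supported V V S).map f)
    ⟨lift 1, (Finsupp.mem_supported V _).2 hXS, hlift 1⟩ hp
    (le_map_lsmul_of_forall_single fun i hi =>
      ⟨_, ⟨_, (Finsupp.mem_supported V _).2 (hσS i hi), rfl⟩, by
        rw [hlift, Algebra.smul_def, mul_inv_cancel_left₀ hp0']⟩)
    (hS.finiteRelations_quotient (fun d => ⟨lift d, hlift d⟩) hκf)
  have hne : S.Nonempty := by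
    by_contra hne
    rw [Set.not_nonempty_iff_eq_empty] at hne
    simp [hne] at htop
  obtain ⟨e, rfl⟩ := hSc.exists_eq_range hne
  choose s a hs hsa using fun n => exists_smul_eq_algebraMap (f (Finsupp.single (e n) 1))
  refine ⟨fun n => ∏ i ∈ Finset.range n, s i, fun n => Finset.prod_ne_zero_iff.2 fun i _ => hs i,
    fun n => ⟨s n, Finset.prod_range_succ _ _⟩, fun t ht => ?_⟩
  let B (n : ℕ) : Submodule V (FractionRing V) :=
    (LinearMap.range (Algebra.linearMap V (FractionRing V))).comap
      (LinearMap.lsmul V _ (∏ i ∈ Finset.range n, s i))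
  have hB : Monotone B := monotone_nat_of_le_succ fun n q hq => by
    obtain ⟨c, hc⟩ := hq
    refine ⟨s n * c, ?_⟩
    simp only [Algebra.linearMap_apply, LinearMap.lsmul_apply, Algebra.smul_def,
      Finset.prod_range_succ, map_mul] at hc ⊢
    rw [hc]
    ring
  have hle : (⊤ : Submodule V (FractionRing V)) ≤ ⨆ n, B n := by
    rw [← htop, Finsupp.supported_eq_span_single, Submodule.map_span, Submodule.span_le]
    rintro _ ⟨_, ⟨_, ⟨n, rfl⟩, rfl⟩, rfl⟩
    refine Submodule.mem_iSup_of_mem (n + 1) ⟨(∏ i ∈ Finset.range n, s i) * a n, ?_⟩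
    rw [Algebra.linearMap_apply, LinearMap.lsmul_apply, Finset.prod_range_succ, mul_smul, hsa,
      map_mul, Algebra.smul_def]
  obtain ⟨n, c, hc⟩ := (Submodule.mem_iSup_of_directed B hB.directed_le).1
    (hle (Submodule.mem_top (x := (algebraMap V _ t)⁻¹)))
  refine ⟨n, c, IsFractionRing.injective V (FractionRing V) ?_⟩
  have ht' : algebraMap V (FractionRing V) t ≠ 0 := by simpa using ht
  rw [Algebra.linearMap_apply, LinearMap.lsmul_apply, Algebra.smul_def] at hc
  rw [map_mul, hc]
  field_simp

section Extension

variable {V D : Type*} [CommRing V] [IsDomain V] [AddCommGroup D] [Module V D]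

/-- Every element of a divisible module is the image of `1` under a map from the fraction field,
if the latter is countably generated. -/
theorem IsDivisibleSubmodule.exists_linearMap {u : ℕ → V} (hu0 : ∀ n, u n ≠ 0)
    (hu : ∀ n, u n ∣ u (n + 1)) (hu' : ∀ s ≠ 0, ∃ n, s ∣ u n) {E : Submodule V D}
    (hE : IsDivisibleSubmodule E) {x : D} (hx : x ∈ E) :
    ∃ ψ : FractionRing V →ₗ[V] D, ψ 1 = x ∧ LinearMap.range ψ ≤ E := by
  choose! quo hquo hquo' using hE
  choose d hd using hu
  have hd0 (n : ℕ) : d n ≠ 0 := by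
    intro h
    exact hu0 (n + 1) (by rw [hd, h, mul_zero])
  let y : ℕ → D := Nat.rec (quo (u 0) x) fun n z => quo (d n) z
  have hyE (n : ℕ) : y n ∈ E := by
    induction n with
    | zero => exact hquo _ (hu0 0) _ hx
    | succ n ih => exact hquo _ (hd0 n) _ ih
  have hy (n : ℕ) : d n • y (n + 1) = y n := hquo' _ (hd0 n) _ (hyE n)
  have hle {n m : ℕ} (h : n ≤ m) : ∃ c, u m = u n * c ∧ c • y m = y n := by
    induction m, h using Nat.le_induction with
    | base => exact ⟨1, by simp⟩
    | succ m _ ih =>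
      obtain ⟨c, hc, hcy⟩ := ih
      exact ⟨c * d m, by rw [hd, hc, mul_assoc], by rw [mul_smul, hy, hcy]⟩
  let rep (q : FractionRing V) (z : D) (n : ℕ) : Prop :=
    ∃ a : V, u n • q = algebraMap V _ a ∧ z = a • y n
  have hmono {q : FractionRing V} {z : D} {n m : ℕ} (h : n ≤ m) (hr : rep q z n) : rep q z m := by
    obtain ⟨a, ha, rfl⟩ := hr
    obtain ⟨c, hc, hcy⟩ := hle h
    refine ⟨a * c, ?_, by rw [mul_smul, hcy]⟩
    rw [hc, mul_comm, mul_smul, ha, map_mul, Algebra.smul_def, mul_comm]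
  have hunique {q : FractionRing V} {z z' : D} {n m : ℕ} (h : rep q z n) (h' : rep q z' m) :
      z = z' := by
    obtain ⟨a, ha, rfl⟩ := hmono (le_max_left n m) h
    obtain ⟨b, hb, rfl⟩ := hmono (le_max_right n m) h'
    rw [IsFractionRing.injective V (FractionRing V) (ha.symm.trans hb)]
  have hex (q : FractionRing V) : ∃ z n, rep q z n := by
    obtain ⟨s, a, hs, h⟩ := exists_smul_eq_algebraMap q
    obtain ⟨n, c, hc⟩ := hu' s hs
    refine ⟨_, n, c * a, ?_, rfl⟩
    rw [hc, mul_comm, mul_smul, h, map_mul, Algebra.smul_def]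
  choose ψ N hψ using hex
  refine ⟨{ toFun := ψ, map_add' := fun q q' => ?_, map_smul' := fun r q => ?_ }, ?_, ?_⟩
  · obtain ⟨a, ha, h⟩ := hmono (le_max_left (N q) (N q')) (hψ q)
    obtain ⟨b, hb, h'⟩ := hmono (le_max_right (N q) (N q')) (hψ q')
    exact hunique (hψ _) (m := max (N q) (N q'))
      ⟨a + b, by rw [smul_add, ha, hb, map_add], by rw [h, h', add_smul]⟩
  · obtain ⟨a, ha, h⟩ := hψ q
    refine hunique (hψ _) (m := N q) ⟨r * a, ?_, by rw [h, mul_smul]; rfl⟩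
    rw [smul_comm, ha, map_mul, Algebra.smul_def]
  · refine hunique (hψ 1) (m := 0) ⟨u 0, ?_, (hquo' _ (hu0 0) _ hx).symm⟩
    rw [Algebra.algebraMap_eq_smul_one]
  · rintro _ ⟨q, rfl⟩
    obtain ⟨a, -, h⟩ := hψ q
    change ψ q ∈ E
    rw [h]
    exact E.smul_mem a (hyE _)

end Extension

section Pieces

variable {V D : Type*} [CommRing V] [IsDomain V] [AddCommGroup D] [Module V D]

/-- A submodule isomorphic to the fraction field `Q`. -/
def IsFractionPiece (B : Submodule V D) : Prop :=
  Nonempty (B ≃ₗ[V] FractionRing V)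

/-- A submodule isomorphic to `Q / V`. -/
def IsQuotientPiece (B : Submodule V D) : Prop :=
  Nonempty (B ≃ₗ[V] (FractionRing V ⧸ LinearMap.range (Algebra.linearMap V (FractionRing V))))

/-- A submodule isomorphic to `Q` or to `Q / V`. -/
def IsPiece (B : Submodule V D) : Prop :=
  IsFractionPiece B ∨ IsQuotientPiece B

theorem isDivisibleSubmodule_range (ψ : FractionRing V →ₗ[V] D) :
    IsDivisibleSubmodule (LinearMap.range ψ) := by
  rintro r hr _ ⟨q, rfl⟩
  have hr' : algebraMap V (FractionRing V) r ≠ 0 := by simpa using hr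
  exact ⟨_, ⟨(algebraMap V _ r)⁻¹ * q, rfl⟩, by
    rw [← map_smul, Algebra.smul_def, mul_inv_cancel_left₀ hr']⟩

theorem IsPiece.isDivisibleSubmodule {B : Submodule V D} (hB : IsPiece B) :
    IsDivisibleSubmodule B := by
  obtain ⟨⟨e⟩⟩ | ⟨⟨e⟩⟩ := hB
  · have := isDivisibleSubmodule_range (B.subtype ∘ₗ e.symm.toLinearMap)
    rwa [LinearMap.range_comp, LinearEquiv.range, Submodule.map_top, Submodule.range_subtype]
      at this
  · have := isDivisibleSubmodule_range (B.subtype ∘ₗ e.symm.toLinearMap ∘ₗ Submodule.mkQ _)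
    rwa [LinearMap.range_comp, LinearMap.range_comp, Submodule.range_mkQ, Submodule.map_top,
      LinearEquiv.range, Submodule.map_top, Submodule.range_subtype] at this

variable [ValuationRing V]

theorem FiniteRelations.sup_range {A : Submodule V D} (hA : FiniteRelations V (D ⧸ A))
    {ψ : FractionRing V →ₗ[V] D}
    (hψ : ∀ q, ψ q ∈ A → q ∈ LinearMap.range (Algebra.linearMap V (FractionRing V))) :
    FiniteRelations V (D ⧸ (A ⊔ LinearMap.range ψ)) := by
  intro n g
  obtain ⟨g', rfl⟩ := Module.projective_lifting_property (A ⊔ LinearMap.range ψ).mkQ g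
    (Submodule.mkQ_surjective _)
  rw [LinearMap.ker_comp, Submodule.ker_mkQ]
  obtain ⟨t, ht0, ht⟩ := exists_smul_mem_of_smul_mem ((A ⊔ V ∙ ψ 1).comap g')
  have ht0' : algebraMap V (FractionRing V) t ≠ 0 := by simpa using ht0
  suffices (A ⊔ LinearMap.range ψ).comap g' =
      (A ⊔ V ∙ ψ (algebraMap V _ t)⁻¹).comap g' from this ▸ hA.fg_comap_sup_span g' _
  refine le_antisymm (fun v hv => ?_) (Submodule.comap_mono (sup_le_sup_left ?_ A))
  · obtain ⟨α, hα, _, ⟨q, rfl⟩, hv⟩ := Submodule.mem_sup.1 hv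
    obtain ⟨s, a, hs, hsa⟩ := exists_smul_eq_algebraMap q
    have hsv : s • v ∈ (A ⊔ V ∙ ψ 1).comap g' := by
      refine Submodule.mem_sup.2 ⟨s • α, A.smul_mem s hα, a • ψ 1,
        Submodule.smul_mem _ _ (Submodule.mem_span_singleton_self _), ?_⟩
      rw [map_smul, ← hv, smul_add, ← map_smul ψ s, hsa, Algebra.algebraMap_eq_smul_one, map_smul]
    obtain ⟨β, hβ, _, hc, h⟩ := Submodule.mem_sup.1 (ht v s hs hsv)
    obtain ⟨c, rfl⟩ := Submodule.mem_span_singleton.1 hc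
    obtain ⟨d, hd⟩ := hψ (t • q - c • 1) (by
      have : ψ (t • q - c • 1) = β - t • α := by
        rw [map_smul, ← hv, smul_add] at h
        rw [map_sub, map_smul, map_smul]
        rw [sub_eq_sub_iff_add_eq_add, add_comm (t • ψ q), ← h]
      rw [this]
      exact sub_mem hβ (A.smul_mem t hα))
    have hq : q = (c + d) • (algebraMap V _ t)⁻¹ := by
      rw [Algebra.linearMap_apply, Algebra.smul_def, Algebra.smul_def, mul_one] at hd
      rw [Algebra.smul_def, map_add, hd]
      field_simp
      ring
    refine Submodule.mem_sup.2 ⟨α, hα, ψ q, ?_, hv⟩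
    rw [hq, map_smul]
    exact Submodule.smul_mem _ _ (Submodule.mem_span_singleton_self _)
  · rw [Submodule.span_singleton_le_iff_mem]
    exact LinearMap.mem_range_self ψ _

/-- A divisible submodule can be enlarged by a copy of `Q` or `Q / V` so as to contain a given
element. -/
theorem FiniteRelations.exists_piece {u : ℕ → V} (hu0 : ∀ n, u n ≠ 0)
    (hu : ∀ n, u n ∣ u (n + 1)) (hu' : ∀ s ≠ 0, ∃ n, s ∣ u n) {A E : Submodule V D}
    (hA : FiniteRelations V (D ⧸ A)) (hAd : IsDivisibleSubmodule A) (hE : IsDivisibleSubmodule E)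
    (hAE : A ≤ E) {x : D} (hx : x ∈ E) (hxA : x ∉ A) :
    ∃ B ≤ E, IsPiece B ∧ Disjoint A B ∧
      x ∈ A ⊔ B ∧ FiniteRelations V (D ⧸ (A ⊔ B)) := by
  obtain ⟨r, hr⟩ := exists_ker_eq_span_singleton hA (A.mkQ x)
  have hr (a : V) : a • x ∈ A ↔ r ∣ a := by
    rw [← hr, ← map_smul, Submodule.mkQ_apply, Submodule.Quotient.mk_eq_zero]
  by_cases hr0 : r = 0
  · subst hr0
    obtain ⟨ψ, hψ1, hψE⟩ := hE.exists_linearMap hu0 hu hu' hx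
    have hψ (q : FractionRing V) (hq : ψ q ∈ A) : q = 0 := by
      obtain ⟨s, a, hs, h⟩ := exists_smul_eq_algebraMap q
      have : a • x ∈ A := by
        rw [← hψ1, ← map_smul, ← Algebra.algebraMap_eq_smul_one, ← h, map_smul]
        exact A.smul_mem s hq
      rw [hr, zero_dvd_iff] at this
      rw [this, map_zero] at h
      exact (smul_eq_zero.1 h).resolve_left hs
    refine ⟨LinearMap.range ψ, hψE, .inl ⟨(LinearEquiv.ofInjective ψ ?_).symm⟩,
      ?_, ?_, hA.sup_range fun q hq => ?_⟩
    · rw [← LinearMap.ker_eq_bot, LinearMap.ker_eq_bot']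
      exact fun q hq => hψ q (hq ▸ A.zero_mem)
    · rw [Submodule.disjoint_def]
      rintro _ h ⟨q, rfl⟩
      rw [hψ q h, map_zero]
    · exact Submodule.mem_sup_right ⟨1, hψ1⟩
    · rw [hψ q hq]
      exact zero_mem _
  · obtain ⟨a', ha', hra'⟩ := hAd r hr0 _ ((hr r).2 dvd_rfl)
    obtain ⟨χ, hχ1, hχE⟩ := hE.exists_linearMap hu0 hu hu' (sub_mem hx (hAE ha'))
    have hχ (a : V) : χ (algebraMap V _ a) = a • (x - a') := by
      rw [Algebra.algebraMap_eq_smul_one, map_smul, hχ1]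
    let ψ := χ ∘ₗ LinearMap.lsmul V _ r
    have hψV (v : V) : ψ (algebraMap V _ v) = 0 := by
      change χ (r • _) = 0
      rw [Algebra.smul_def, ← map_mul, hχ, mul_comm, mul_smul, smul_sub, hra', sub_self, smul_zero]
    have hψ (q : FractionRing V) (hq : ψ q ∈ A) :
        q ∈ LinearMap.range (Algebra.linearMap V (FractionRing V)) := by
      replace hq : χ (r • q) ∈ A := hq
      obtain ⟨b, hb⟩ | ⟨c, hc⟩ := exists_smul_eq_or_smul_eq 1 (r • q)
      · rw [← hb, ← Algebra.algebraMap_eq_smul_one, hχ, smul_sub,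
          A.sub_mem_iff_left (A.smul_mem b ha'), hr] at hq
        obtain ⟨d, rfl⟩ := hq
        refine ⟨d, smul_right_injective _ hr0 ?_⟩
        change r • algebraMap V _ d = r • q
        rw [← hb, mul_smul, ← Algebra.algebraMap_eq_smul_one]
      · refine absurd ?_ hxA
        have h := A.smul_mem c hq
        rwa [← map_smul, hc, hχ1, A.sub_mem_iff_left ha'] at h
    have hker : LinearMap.ker ψ = LinearMap.range (Algebra.linearMap V (FractionRing V)) := by
      refine le_antisymm (fun q hq => hψ q ?_) ?_
      · rw [LinearMap.mem_ker.1 hq]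
        exact A.zero_mem
      · rintro _ ⟨v, rfl⟩
        exact hψV v
    refine ⟨LinearMap.range ψ, (LinearMap.range_comp_le_range _ _).trans hχE,
      .inr ⟨ψ.quotKerEquivRange.symm ≪≫ₗ Submodule.quotEquivOfEq _ _ hker⟩,
      ?_, ?_, hA.sup_range hψ⟩
    · rw [Submodule.disjoint_def]
      rintro _ h ⟨q, rfl⟩
      obtain ⟨v, rfl⟩ := hψ q h
      exact hψV v
    · refine Submodule.mem_sup.2 ⟨a', ha', _, ⟨(algebraMap V _ r)⁻¹, rfl⟩, ?_⟩
      have hr0' : algebraMap V (FractionRing V) r ≠ 0 := by simpa using hr0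
      change a' + χ (r • _) = x
      rw [Algebra.smul_def, mul_inv_cancel₀ hr0', hχ1]
      abel

end Pieces

theorem sSupIndep.insert_of_disjoint {α : Type*} [CompleteLattice α] [IsModularLattice α]
    {s : Set α} (hs : sSupIndep s) {b : α} (hb : Disjoint (sSup s) b) :
    sSupIndep (insert b s) := by
  intro a ha
  by_cases hab : a = b
  · subst hab
    exact hb.symm.mono_right (sSup_le_sSup fun c hc => hc.1.resolve_left hc.2)
  · replace ha := ha.resolve_left hab
    refine (Disjoint.disjoint_sup_right_of_disjoint_sup_left (hs ha)
      (hb.mono_left (sup_le (le_sSup ha) (sSup_le_sSup Set.sdiff_subset)))).mono_right ?_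
    refine sSup_le fun c hc => ?_
    obtain rfl | hcs := hc.1
    · exact le_sup_right
    · exact le_sup_of_le_left (le_sSup ⟨hcs, hc.2⟩)

section Decomposition

variable {V D : Type*} [CommRing V] [IsDomain V] [ValuationRing V] [AddCommGroup D] [Module V D]

theorem exists_pieces_extension {u : ℕ → V} (hu0 : ∀ n, u n ≠ 0)
    (hu : ∀ n, u n ∣ u (n + 1)) (hu' : ∀ s ≠ 0, ∃ n, s ∣ u n)
    {E : Submodule V D} (hE : IsDivisibleSubmodule E)
    {𝒜 : Set (Submodule V D)} (h𝒜 : sSupIndep 𝒜) (hp : ∀ A ∈ 𝒜, IsPiece A) (hle : sSup 𝒜 ≤ E)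
    (hfr : FiniteRelations V (D ⧸ sSup 𝒜)) {x : D} (hx : x ∈ E) :
    ∃ ℬ, 𝒜 ⊆ ℬ ∧ sSupIndep ℬ ∧ (∀ A ∈ ℬ, IsPiece A) ∧ sSup ℬ ≤ E ∧
      FiniteRelations V (D ⧸ sSup ℬ) ∧ x ∈ sSup ℬ := by
  by_cases hxA : x ∈ sSup 𝒜
  · exact ⟨𝒜, Set.Subset.rfl, h𝒜, hp, hle, hfr, hxA⟩
  obtain ⟨B, hBE, hB, hdisj, hxB, hfr'⟩ := hfr.exists_piece hu0 hu hu'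
    (isDivisibleSubmodule_sSup fun A hA => (hp A hA).isDivisibleSubmodule) hE hle hx hxA
  have hsup : sSup (insert B 𝒜) = sSup 𝒜 ⊔ B := by rw [sSup_insert, sup_comm]
  refine ⟨insert B 𝒜, Set.subset_insert _ _, h𝒜.insert_of_disjoint hdisj, ?_, ?_, ?_, ?_⟩
  · rintro A (rfl | hA)
    exacts [hB, hp A hA]
  · rw [hsup]
    exact sup_le hle hBE
  · rwa [hsup]
  · rwa [hsup]

theorem exists_pieces_extension_of_countable {u : ℕ → V} (hu0 : ∀ n, u n ≠ 0)
    (hu : ∀ n, u n ∣ u (n + 1)) (hu' : ∀ s ≠ 0, ∃ n, s ∣ u n)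
    {E : Submodule V D} (hE : IsDivisibleSubmodule E)
    {𝒜 : Set (Submodule V D)} (h𝒜 : sSupIndep 𝒜) (hp : ∀ A ∈ 𝒜, IsPiece A) (hle : sSup 𝒜 ≤ E)
    (hfr : FiniteRelations V (D ⧸ sSup 𝒜)) {x : ℕ → D} (hx : ∀ n, x n ∈ E) :
    ∃ ℬ, 𝒜 ⊆ ℬ ∧ sSupIndep ℬ ∧ (∀ A ∈ ℬ, IsPiece A) ∧ sSup ℬ ≤ E ∧ ∀ n, x n ∈ sSup ℬ := by
  let good := {ℬ : Set (Submodule V D) // sSupIndep ℬ ∧ (∀ A ∈ ℬ, IsPiece A) ∧ sSup ℬ ≤ E ∧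
    FiniteRelations V (D ⧸ sSup ℬ)}
  have step (n : ℕ) (ℬ : good) : ∃ 𝒞 : good, ℬ.1 ⊆ 𝒞.1 ∧ x n ∈ sSup 𝒞.1 := by
    obtain ⟨ℬ, h1, h2, h3, h4⟩ := ℬ
    obtain ⟨𝒞, h, h1, h2, h3, h4, h5⟩ :=
      exists_pieces_extension hu0 hu hu' hE h1 h2 h3 h4 (hx n)
    exact ⟨⟨𝒞, h1, h2, h3, h4⟩, h, h5⟩
  choose next hsub hmem using step
  let Z : ℕ → good := Nat.rec ⟨𝒜, h𝒜, hp, hle, hfr⟩ next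
  have hmono : Monotone fun n => (Z n).1 := monotone_nat_of_le_succ fun n => hsub n (Z n)
  refine ⟨⋃ n, (Z n).1, Set.subset_iUnion (fun n => (Z n).1) 0,
    sSupIndep_iUnion_of_directed hmono.directed_le fun n => (Z n).2.1, ?_, ?_, fun n => ?_⟩
  · intro A hA
    obtain ⟨n, hn⟩ := Set.mem_iUnion.1 hA
    exact (Z n).2.2.1 A hn
  · rw [sSup_iUnion]
    exact iSup_le fun n => (Z n).2.2.2.1
  · exact sSup_le_sSup (Set.subset_iUnion (fun n => (Z n).1) (n + 1)) (hmem n (Z n))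

/-- A divisible module of projective dimension at most one is a direct sum of copies of `Q` and
`Q / V`. -/
theorem exists_sSupIndep_pieces_sSup_eq_top {u : ℕ → V} (hu0 : ∀ n, u n ≠ 0)
    (hu : ∀ n, u n ∣ u (n + 1)) (hu' : ∀ s ≠ 0, ∃ n, s ∣ u n)
    {I J : Type*} {f : (I →₀ V) →ₗ[V] D}
    {κ : (J →₀ V) →ₗ[V] (I →₀ V)} (hf : Function.Surjective f) (hκ : Function.Injective κ)
    (hκf : LinearMap.range κ = LinearMap.ker f) (hD : Divisible V D) :
    ∃ 𝒜 : Set (Submodule V D), sSupIndep 𝒜 ∧ (∀ A ∈ 𝒜, IsPiece A) ∧ sSup 𝒜 = ⊤ := by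
  have hdiv (n : ℕ) (i : I) : ∃ y, u n • f y = f (Finsupp.single i 1) := by
    obtain ⟨e, he⟩ := hD (u n) (hu0 n) (f (Finsupp.single i 1))
    obtain ⟨y, rfl⟩ := hf e
    exact ⟨y, he⟩
  choose y hy using hdiv
  let σ (i : I) : Set I := ⋃ n, ((y n i).support : Set I)
  have hσ (i : I) : (σ i).Countable := Set.countable_iUnion fun n => Finset.countable_toSet _
  have hσdiv {S : Set I} (hS : ∀ i ∈ S, σ i ⊆ S) :
      IsDivisibleSubmodule ((Finsupp.supported V V S).map f) := by
    rw [isDivisibleSubmodule_iff]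
    refine fun r hr => le_map_lsmul_of_forall_single fun i hi => ?_
    obtain ⟨n, c, hc⟩ := hu' r hr
    refine ⟨_, ⟨c • y n i, Submodule.smul_mem _ _ ((Finsupp.mem_supported V _).2
      ((Set.subset_iUnion _ n).trans (hS i hi))), rfl⟩, ?_⟩
    rw [map_smul, ← mul_smul, ← hc, hy]
  let good : Set (Set (Submodule V D) × Set I) := {p | sSupIndep p.1 ∧ (∀ A ∈ p.1, IsPiece A) ∧
    Adapted κ p.2 ∧ (∀ i ∈ p.2, σ i ⊆ p.2) ∧ sSup p.1 = (Finsupp.supported V V p.2).map f}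
  have hempty : ((∅, ∅) : Set (Submodule V D) × Set I) ∈ good :=
    ⟨sSupIndep_empty, by simp, adapted_empty hκ, by simp, by simp⟩
  obtain ⟨⟨𝒜, S⟩, -, ⟨h𝒜, hp, hS, hσS, hsup⟩, hmax⟩ :=
    zorn_le_nonempty₀ good (fun c hc hchain p hpc => by
      have : Nonempty c := ⟨⟨p, hpc⟩⟩
      have hdir : Directed (· ≤ ·) (Subtype.val : c → _) := hchain.directedOn.directed_val
      have hd1 : Directed (· ⊆ ·) fun q : c => q.1.1 := hdir.mono_comp _ fun _ _ h => h.1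
      have hd2 : Directed (· ⊆ ·) fun q : c => q.1.2 := hdir.mono_comp _ fun _ _ h => h.2
      refine ⟨(⋃ q : c, q.1.1, ⋃ q : c, q.1.2), ⟨?_, ?_, ?_, ?_, ?_⟩, fun q hq =>
        ⟨Set.subset_iUnion (fun q : c => q.1.1) ⟨q, hq⟩,
          Set.subset_iUnion (fun q : c => q.1.2) ⟨q, hq⟩⟩⟩
      · exact sSupIndep_iUnion_of_directed hd1 fun q => (hc q.2).1
      · intro A hA
        obtain ⟨q, hq⟩ := Set.mem_iUnion.1 hA
        exact (hc q.2).2.1 A hq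
      · exact adapted_iUnion_of_directed hd2 fun q => ⟨q, (hc q.2).2.2.1⟩
      · intro i hi
        obtain ⟨q, hq⟩ := Set.mem_iUnion.1 hi
        exact ((hc q.2).2.2.2.1 i hq).trans (Set.subset_iUnion (fun q : c => q.1.2) q)
      · rw [sSup_iUnion, Finsupp.supported_iUnion, Submodule.map_iSup]
        exact iSup_congr fun q => (hc q.2).2.2.2.2) _ hempty
  dsimp only at h𝒜 hp hS hσS hsup
  refine ⟨𝒜, h𝒜, hp, ?_⟩
  suffices S = Set.univ by
    rw [hsup, this, Finsupp.supported_univ, Submodule.map_top, LinearMap.range_eq_top.2 hf]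
  refine Set.eq_univ_of_forall fun i => ?_
  obtain ⟨Y, hiY, hY, hσY, hSY⟩ := hS.exists_countable_extension σ hσ (Set.countable_singleton i)
  have hσSY : ∀ j ∈ S ∪ Y, σ j ⊆ S ∪ Y := by
    rintro j (hj | hj)
    · exact (hσS j hj).trans Set.subset_union_left
    · exact (hσY j hj).trans Set.subset_union_right
  obtain ⟨e, rfl⟩ := hY.exists_eq_range ⟨i, hiY rfl⟩
  obtain ⟨ℬ, h1, h2, h3, h4, h5⟩ := exists_pieces_extension_of_countable hu0 hu hu' (hσdiv hσSY)
    h𝒜 hp (hsup.trans_le (Submodule.map_mono (Finsupp.supported_mono Set.subset_union_left)))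
    (hsup ▸ hS.finiteRelations_quotient hf hκf) (x := fun n => f (Finsupp.single (e n) 1))
    fun n => ⟨_, Finsupp.single_mem_supported V _ (.inr ⟨n, rfl⟩), rfl⟩
  refine (hmax (y := (ℬ, S ∪ Set.range e)) ⟨h2, h3, hSY, hσSY, h4.antisymm ?_⟩
    ⟨h1, Set.subset_union_left⟩).2 (.inr (hiY rfl))
  rw [Finsupp.supported_union, Submodule.map_sup, ← hsup]
  refine sup_le (sSup_le_sSup h1) ?_
  rw [Finsupp.supported_eq_span_single, Submodule.map_span, Submodule.span_le]
  rintro _ ⟨_, ⟨_, ⟨n, rfl⟩, rfl⟩, rfl⟩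
  exact h5 n

end Decomposition

section DirectSums

variable {V D : Type*} [CommRing V] [AddCommGroup D] [Module V D]

theorem sSupIndep.exists_finsupp_linearMap {𝒜 : Set (Submodule V D)} (h𝒜 : sSupIndep 𝒜)
    {M : Type*} [AddCommGroup M] [Module V M] (e : ∀ A ∈ 𝒜, Nonempty (A ≃ₗ[V] M)) :
    ∃ φ : (𝒜 →₀ M) →ₗ[V] D, Function.Injective φ ∧ LinearMap.range φ = sSup 𝒜 := by
  classical
  let E : (𝒜 →₀ M) ≃ₗ[V] Π₀ A : 𝒜, A.1 :=
    finsuppLequivDFinsupp V ≪≫ₗ DFinsupp.mapRange.linearEquiv fun A => (e A.1 A.2).some.symm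
  refine ⟨DFinsupp.lsum ℕ (fun A : 𝒜 => A.1.subtype) ∘ₗ E.toLinearMap, ?_, ?_⟩
  · exact ((sSupIndep_iff 𝒜).1 h𝒜).dfinsupp_lsum_injective.comp E.injective
  · rw [LinearMap.range_comp, LinearEquiv.range, Submodule.map_top,
      ← Submodule.iSup_eq_range_dfinsupp_lsum, sSup_eq_iSup']

theorem sSupIndep.disjoint_sSup_sSup {𝒜 ℬ 𝒞 : Set (Submodule V D)} (h𝒜 : sSupIndep 𝒜)
    (hℬ : ℬ ⊆ 𝒜) (h𝒞 : 𝒞 ⊆ 𝒜) (h : Disjoint ℬ 𝒞) : Disjoint (sSup ℬ) (sSup 𝒞) := by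
  have hsup {ℬ : Set (Submodule V D)} (hℬ : ℬ ⊆ 𝒜) :
      ⨆ A ∈ ((↑) ⁻¹' ℬ : Set 𝒜), (A : Submodule V D) = sSup ℬ := by
    rw [← sSup_image, Subtype.image_preimage_coe, Set.inter_eq_self_of_subset_right hℬ]
  rw [← hsup hℬ, ← hsup h𝒞]
  exact ((sSupIndep_iff 𝒜).1 h𝒜).disjoint_biSup_biSup (h.preimage _)

theorem exists_linearEquiv_of_sSupIndep_pieces {𝒜 : Set (Submodule V D)} (h𝒜 : sSupIndep 𝒜)
    (hp : ∀ A ∈ 𝒜, IsPiece A) (htop : sSup 𝒜 = ⊤) :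
    ∃ ℬ 𝒞 : Set (Submodule V D), Nonempty (D ≃ₗ[V] ((ℬ →₀ FractionRing V) ×
      (𝒞 →₀ (FractionRing V ⧸ LinearMap.range (Algebra.linearMap V (FractionRing V)))))) := by
  let ℬ := {A ∈ 𝒜 | IsFractionPiece A}
  let 𝒞 := {A ∈ 𝒜 | ¬ IsFractionPiece A}
  have hℬ : ℬ ⊆ 𝒜 := fun A hA => hA.1
  have h𝒞 : 𝒞 ⊆ 𝒜 := fun A hA => hA.1
  have hℬ𝒞 : Disjoint ℬ 𝒞 := Set.disjoint_left.2 fun A hA hA' => hA'.2 hA.2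
  obtain ⟨φ, hφ, hφr⟩ := (h𝒜.mono hℬ).exists_finsupp_linearMap fun A hA => hA.2
  obtain ⟨ψ, hψ, hψr⟩ := (h𝒜.mono h𝒞).exists_finsupp_linearMap fun A hA =>
    (hp A hA.1).resolve_left hA.2
  refine ⟨ℬ, 𝒞, ⟨(LinearEquiv.ofBijective (φ.coprod ψ) ⟨?_, ?_⟩).symm⟩⟩
  · rw [← LinearMap.ker_eq_bot, LinearMap.ker_coprod_of_disjoint_range, LinearMap.ker_eq_bot.2 hφ,
      LinearMap.ker_eq_bot.2 hψ, Submodule.prod_bot]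
    rw [hφr, hψr]
    exact h𝒜.disjoint_sSup_sSup hℬ h𝒞 hℬ𝒞
  · rw [← LinearMap.range_eq_top, LinearMap.range_coprod, hφr, hψr, ← sSup_union, ← htop]
    congr 1
    ext A
    exact ⟨fun h => h.elim (fun h => h.1) fun h => h.1, fun h =>
      (em (IsFractionPiece A)).imp (fun h' => ⟨h, h'⟩) fun h' => ⟨h, h'⟩⟩

theorem Divisible.of_surjective {M : Type*} [AddCommGroup M] [Module V M] (hM : Divisible V M)
    {f : M →ₗ[V] D} (hf : Function.Surjective f) : Divisible V D := by
  intro r hr d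
  obtain ⟨m, rfl⟩ := hf d
  obtain ⟨e, rfl⟩ := hM r hr m
  exact ⟨f e, (map_smul f r e).symm⟩

theorem divisible_fractionRing [IsDomain V] : Divisible V (FractionRing V) := by
  intro r hr q
  have hr' : algebraMap V (FractionRing V) r ≠ 0 := by simpa using hr
  exact ⟨(algebraMap V _ r)⁻¹ * q, by rw [Algebra.smul_def, mul_inv_cancel_left₀ hr']⟩

theorem Divisible.finsupp (hD : Divisible V D) (ι : Type*) : Divisible V (ι →₀ D) := by
  intro r hr x
  induction x using Finsupp.induction_linear with
  | zero => exact ⟨0, smul_zero r⟩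
  | add x y hx hy =>
    obtain ⟨a, rfl⟩ := hx
    obtain ⟨b, rfl⟩ := hy
    exact ⟨a + b, smul_add r a b⟩
  | single i d =>
    obtain ⟨e, rfl⟩ := hD r hr d
    exact ⟨Finsupp.single i e, Finsupp.smul_single r i e⟩

theorem Divisible.prod {M : Type*} [AddCommGroup M] [Module V M] (hM : Divisible V M)
    (hD : Divisible V D) : Divisible V (M × D) := by
  rintro r hr ⟨m, d⟩
  obtain ⟨a, rfl⟩ := hM r hr m
  obtain ⟨b, rfl⟩ := hD r hr d
  exact ⟨(a, b), rfl⟩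

end DirectSums

/-- over a Matlis valuation domain, a module of p.d. ≤ 1 is divisible
iff it is a direct sum of copies of `Q` and copies of `K = Q/V`. -/
theorem statement14 (V : Type u) [CommRing V] [IsDomain V] [ValuationRing V]
    (hMatlis : PdLeOne V (FractionRing V))
    (D : Type v) [AddCommGroup D] [Module V D] (hD : PdLeOne V D) :
    Divisible V D ↔
      ∃ (ι κ : Type (max u v)),
        Nonempty (D ≃ₗ[V] ((ι →₀ FractionRing V) ×
          (κ →₀ ((FractionRing V) ⧸
            LinearMap.range (Algebra.linearMap V (FractionRing V)))))) := by
  constructor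
  · intro hdiv
    obtain ⟨u, hu0, hu, hu'⟩ := exists_cofinal_sequence hMatlis
    obtain ⟨I, J, f, κ, hf, hκ, hκf⟩ := hD.exists_free_resolution
    obtain ⟨𝒜, h𝒜, hp, htop⟩ := exists_sSupIndep_pieces_sSup_eq_top hu0 hu hu' hf hκ hκf hdiv
    obtain ⟨ℬ, 𝒞, ⟨e⟩⟩ := exists_linearEquiv_of_sSupIndep_pieces h𝒜 hp htop
    exact ⟨ULift.{u} ℬ, ULift.{u} 𝒞, ⟨e ≪≫ₗ (Finsupp.domLCongr Equiv.ulift.symm).prodCongr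
      (Finsupp.domLCongr Equiv.ulift.symm)⟩⟩
  · rintro ⟨ι, κ, ⟨e⟩⟩
    exact ((divisible_fractionRing.finsupp ι).prod ((divisible_fractionRing.of_surjective
      (Submodule.mkQ_surjective _)).finsupp κ)).of_surjective (f := e.symm.toLinearMap)
        e.symm.surjective
end

section
/- Let V be a valuation domain and E a V-module with pd E ≤ 1. Then Ext¹_V(C, E) = 0 for every V-module C with pd C ≤ 1 if and only if E is divisible. -/
universe u v

open Pointwise

section Valuation

variable {V : Type*} [CommRing V] [IsDomain V] [ValuationRing V]

theorem fg_inf_ker_of_fg {M : Type*} [AddCommGroup M] [Module V M] {N : Submodule V M}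
    (hN : N.FG) (f : M →ₗ[V] V) : (N ⊓ LinearMap.ker f).FG := by
  obtain ⟨d, hd⟩ : ∃ d, N.map f = V ∙ d :=
    ((IsBezout.isPrincipal_of_FG (N.map f : Ideal V) (hN.map f))).principal
  have : Module.FinitePresentation V (N.map f) := by
    rw [hd]
    by_cases h : d = 0
    · subst h
      rw [Submodule.span_zero_singleton]
      exact Module.finitePresentation_of_projective V _
    · exact Module.FinitePresentation.of_equiv (LinearEquiv.toSpanNonzeroSingleton V V d h)
  have : Module.Finite V N := Module.Finite.of_fg hN
  have h := (Module.FinitePresentation.fg_ker (f.submoduleMap N)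
    (f.submoduleMap_surjective N)).map N.subtype
  convert h using 1
  ext x
  simp only [Submodule.mem_inf, LinearMap.mem_ker, Submodule.mem_map, Submodule.subtype_apply,
    Subtype.exists, Subtype.ext_iff]
  constructor
  · rintro ⟨h1, h2⟩
    exact ⟨x, h1, h2, rfl⟩
  · rintro ⟨y, h1, h2, rfl⟩
    exact ⟨h1, h2⟩

theorem fg_inf_iInf_ker_of_fg {M ι : Type*} [AddCommGroup M] [Module V M] {N : Submodule V M}
    (hN : N.FG) (f : ι → M →ₗ[V] V) (G : Finset ι) :
    (N ⊓ ⨅ g ∈ G, LinearMap.ker (f g)).FG := by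
  classical
  induction G using Finset.induction_on with
  | empty => simpa using hN
  | insert a G _ ih =>
    rw [Finset.iInf_insert, inf_comm (LinearMap.ker _), ← inf_assoc]
    exact fg_inf_ker_of_fg ih _

end Valuation

section Extension

variable {V : Type*} [CommRing V] {F E : Type*} [AddCommGroup F] [Module V F]
  [AddCommGroup E] [Module V E]

/-- A partial linear map into a divisible module extends to one more element whose conductor into
the domain is principal. -/
theorem LinearPMap.exists_extend_span_singleton (hE : Divisible V E) (f : F →ₗ.[V] E) (x : F)
    (hx : (Submodule.comap (LinearMap.toSpanSingleton V F x) f.domain).IsPrincipal) :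
    ∃ g : F →ₗ.[V] E, f ≤ g ∧ g.domain = f.domain ⊔ V ∙ x := by
  obtain ⟨d, hd⟩ := hx.principal
  have hmem : ∀ c : V, c • x ∈ f.domain ↔ ∃ k : V, k * d = c := fun c => by
    simp_rw [← smul_eq_mul]
    rw [← Submodule.mem_span_singleton, ← hd]
    simp
  have hdx : d • x ∈ f.domain := (hmem d).2 ⟨1, one_mul d⟩
  obtain ⟨e, he⟩ : ∃ e : E, d • e = f ⟨d • x, hdx⟩ := by
    by_cases h : d = 0
    · subst h
      refine ⟨0, ?_⟩
      rw [smul_zero, ← f.map_zero]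
      congr 1
      ext
      simp
    · exact hE d h _
  have key : ∀ (c : V) (h : c • x ∈ f.domain), c • e = f ⟨c • x, h⟩ := by
    intro c h
    obtain ⟨k, rfl⟩ := (hmem c).1 h
    rw [mul_smul, he, ← f.map_smul]
    congr 1
    ext
    simp [mul_smul]
  have H : ∀ c : V, c • x = 0 → c • e = 0 := fun c hc => by
    rw [key c (hc ▸ f.domain.zero_mem), ← f.map_zero]
    congr 1
    ext
    exact hc
  refine ⟨f.sup (LinearPMap.mkSpanSingleton' x e H) ?_, LinearPMap.left_le_sup _ _ _, rfl⟩
  rintro ⟨a, ha⟩ ⟨b, hb⟩ (rfl : a = b)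
  obtain ⟨c, rfl⟩ := Submodule.mem_span_singleton.1 hb
  rw [LinearPMap.mkSpanSingleton'_apply]
  exact (key c ha).symm

end Extension

section Saturated

variable {V : Type*} [CommRing V] {X Y : Type*}

/-- A set `S` of basis vectors of the target is saturated for `i` if every vector mapped by `i`
into the span of `S` is a combination of basis vectors mapped by `i` into the span of `S`. -/
def Saturated (i : (Y →₀ V) →ₗ[V] X →₀ V) (S : Set X) : Prop :=
  ∀ z, i z ∈ Finsupp.supported V V S →
    z ∈ Finsupp.supported V V {y | i (Finsupp.single y 1) ∈ Finsupp.supported V V S}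

variable {i : (Y →₀ V) →ₗ[V] X →₀ V}

theorem map_mem_supported_of_mem {S : Set X} {z : Y →₀ V}
    (hz : z ∈ Finsupp.supported V V {y | i (Finsupp.single y 1) ∈ Finsupp.supported V V S}) :
    i z ∈ Finsupp.supported V V S := by
  rw [Finsupp.supported_eq_span_single] at hz
  rw [← Submodule.mem_comap]
  refine Submodule.span_le.2 ?_ hz
  rintro _ ⟨y, hy, rfl⟩
  exact hy

theorem saturated_empty (hi : Function.Injective i) : Saturated i ∅ := by
  intro z hz
  have : i z = 0 := by simpa using hz
  rw [(map_eq_zero_iff i hi).1 this]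
  exact Submodule.zero_mem _

theorem Saturated.biUnion {ι : Type*} {c : Set ι} {S : ι → Set X} (hne : c.Nonempty)
    (hdir : DirectedOn (fun a b => S a ⊆ S b) c) (hS : ∀ a ∈ c, Saturated i (S a)) :
    Saturated i (⋃ a ∈ c, S a) := by
  intro z hz
  obtain ⟨a, ha, hza⟩ := DirectedOn.exists_mem_subset_of_finset_subset_biUnion hne hdir
    ((Finsupp.mem_supported _ _).1 hz)
  have hle : S a ⊆ ⋃ a ∈ c, S a := Set.subset_biUnion_of_mem ha
  refine Finsupp.supported_mono ?_ (hS a ha z ((Finsupp.mem_supported _ _).2 hza))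
  exact fun y hy => Finsupp.supported_mono (R := V) (M := V) hle hy

variable [IsDomain V]

theorem Saturated.exists_finset {S : Set X} (hS : Saturated i S) (B : Finset X) :
    ∃ W : Finset Y, ∀ z, i z ∈ Finsupp.supported V V (S ∪ B) →
      z ∈ Finsupp.supported V V
        ({y | i (Finsupp.single y 1) ∈ Finsupp.supported V V S} ∪ (W : Set Y)) := by
  classical
  induction B using Finset.induction_on with
  | empty => exact ⟨∅, fun z hz => by simpa using hS z (by simpa using hz)⟩
  | insert x B _ ih =>
    obtain ⟨W, hW⟩ := ih
    have hx : ∀ z, i z ∈ Finsupp.supported V V (S ∪ (insert x B : Finset X)) → i z x = 0 →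
        i z ∈ Finsupp.supported V V (S ∪ B) := fun z hz h0 => by
      rw [Finsupp.mem_supported'] at hz ⊢
      intro y hy
      by_cases hyx : y = x
      · rwa [hyx]
      · exact hz y (by simpa [hyx] using hy)
    by_cases h : ∃ z₀, i z₀ ∈ Finsupp.supported V V (S ∪ (insert x B : Finset X)) ∧ i z₀ x ≠ 0
    · obtain ⟨z₀, hz₀, hne⟩ := h
      refine ⟨W ∪ z₀.support, fun z hz => ?_⟩
      have h1 := hW (i z₀ x • z - i z x • z₀) (hx _ ?_ ?_)
      · rw [Finsupp.mem_supported'] at h1 ⊢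
        intro y hy
        simp only [Finset.coe_union, Set.mem_union, not_or] at hy
        have h2 := h1 y (by simpa using And.intro hy.1 hy.2.1)
        have h3 : z₀ y = 0 := by simpa using hy.2.2
        simpa [h3, hne] using h2
      · rw [map_sub, map_smul, map_smul]
        exact Submodule.sub_mem _ (Submodule.smul_mem _ _ hz) (Submodule.smul_mem _ _ hz₀)
      · simp [mul_comm]
    · push Not at h
      exact ⟨W, fun z hz => hW z (hx z hz (h z hz))⟩

/-- Any basis vector lies in a saturated set obtained from a given saturated set by adding
countably many basis vectors. -/
theorem Saturated.exists_countable {S : Set X} (hS : Saturated i S) (x : X) :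
    ∃ e : ℕ → X, x ∈ Set.range e ∧ Saturated i (S ∪ Set.range e) := by
  classical
  choose W hW using hS.exists_finset
  let next : Finset X → Finset X := fun B =>
    B ∪ (W B).biUnion fun y => (i (Finsupp.single y 1)).support
  let B : ℕ → Finset X := fun n => next^[n] {x}
  have hB : ∀ n, B (n + 1) = next (B n) := fun n => Function.iterate_succ_apply' _ _ _
  have hmono : Monotone B := monotone_nat_of_le_succ fun n => by
    rw [hB]
    exact Finset.subset_union_left
  have hxB : x ∈ ⋃ n, (B n : Set X) := Set.mem_iUnion.2 ⟨0, by simp [B]⟩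
  obtain ⟨e, he⟩ := (Set.countable_iUnion fun n => (B n).countable_toSet).exists_eq_range ⟨x, hxB⟩
  refine ⟨e, he ▸ hxB, ?_⟩
  rw [← he]
  intro z hz
  have hz' : ∃ n, ((i z).support : Set X) ⊆ S ∪ B n := by
    have := DirectedOn.exists_mem_subset_of_finset_subset_biUnion (c := Set.univ)
      (f := fun n => S ∪ (B n : Set X)) (s := (i z).support) Set.univ_nonempty ?_ ?_
    · simpa using this
    · intro a _ b _
      refine ⟨max a b, trivial, ?_, ?_⟩
      · exact Set.union_subset_union_right _ (Finset.coe_subset.2 (hmono (le_max_left a b)))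
      · exact Set.union_subset_union_right _ (Finset.coe_subset.2 (hmono (le_max_right a b)))
    · rw [Set.biUnion_univ, ← Set.union_iUnion]
      exact (Finsupp.mem_supported _ _).1 hz
  obtain ⟨n, hn⟩ := hz'
  refine Finsupp.supported_mono (M := V) (R := V) ?_ (hW (B n) z ((Finsupp.mem_supported _ _).2 hn))
  rintro y (hy | hy)
  · exact Finsupp.supported_mono (R := V) (M := V) Set.subset_union_left hy
  · refine (Finsupp.mem_supported V _).2 fun a ha => Or.inr (Set.mem_iUnion.2 ⟨n + 1, ?_⟩)
    rw [hB]
    exact Finset.mem_coe.2 (Finset.mem_union_right _ (Finset.mem_biUnion.2 ⟨y, hy, ha⟩))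

variable [ValuationRing V]

theorem Saturated.isPrincipal_comap {S : Set X} (hS : Saturated i S) (B : Finset X) (x : X)
    (hxS : x ∉ S ∪ B) :
    (Submodule.comap (LinearMap.toSpanSingleton V (X →₀ V) (Finsupp.single x 1))
      (LinearMap.range i ⊔ Finsupp.supported V V (S ∪ B))).IsPrincipal := by
  classical
  obtain ⟨W, hW⟩ := hS.exists_finset (insert x B)
  let U : Set X := S ∪ (insert x B : Finset X)
  let G : Finset X :=
    (W.biUnion fun y => (i (Finsupp.single y 1)).support).filter fun a => a ∉ U
  have hsub : S ∪ (B : Set X) ⊆ U := Set.union_subset_union_right _ (by simp)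
  have hxU : x ∈ U := Or.inr (by simp)
  have hP : (Finsupp.supported V V (W : Set Y) ⊓
      ⨅ g ∈ G, LinearMap.ker (Finsupp.lapply g ∘ₗ i)).FG := by
    refine fg_inf_iInf_ker_of_fg ?_ _ G
    rw [Finsupp.supported_eq_span_single]
    exact Submodule.fg_span (W.finite_toSet.image _)
  have hPmem : ∀ z ∈ Finsupp.supported V V (W : Set Y),
      (z ∈ ⨅ g ∈ G, LinearMap.ker (Finsupp.lapply g ∘ₗ i)) ↔ i z ∈ Finsupp.supported V V U := by
    intro z hz
    have hz' : i z ∈ Finsupp.supported V V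
        ((W.biUnion fun y => (i (Finsupp.single y 1)).support : Finset X) : Set X) := by
      refine map_mem_supported_of_mem (Finsupp.supported_mono (fun y hy => ?_) hz)
      refine (Finsupp.mem_supported V _).2 fun a ha => ?_
      exact Finset.mem_coe.2 (Finset.mem_biUnion.2 ⟨y, hy, ha⟩)
    rw [Finsupp.mem_supported'] at hz' ⊢
    simp only [Submodule.mem_iInf, LinearMap.mem_ker, LinearMap.comp_apply, Finsupp.lapply_apply]
    constructor
    · intro h a ha
      by_cases haW : a ∈ (W.biUnion fun y => (i (Finsupp.single y 1)).support : Finset X)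
      · exact h a (Finset.mem_filter.2 ⟨haW, ha⟩)
      · exact hz' a haW
    · intro h a ha
      exact h a (Finset.mem_filter.1 ha).2
  have hI := IsBezout.isPrincipal_of_FG (R := V)
    (Submodule.map ((Finsupp.lapply x : (X →₀ V) →ₗ[V] V) ∘ₗ i) _) 
    (hP.map ((Finsupp.lapply x : (X →₀ V) →ₗ[V] V) ∘ₗ i))
  convert hI using 1
  ext r
  simp only [Submodule.mem_comap, LinearMap.toSpanSingleton_apply, Submodule.mem_map,
    LinearMap.comp_apply, Finsupp.lapply_apply]
  constructor
  · intro hr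
    obtain ⟨_, ⟨z, rfl⟩, t, ht, hzt⟩ := Submodule.mem_sup.1 hr
    have htU := Finsupp.supported_mono hsub ht
    have hzU : i z ∈ Finsupp.supported V V U := by
      rw [eq_sub_of_add_eq hzt]
      exact Submodule.sub_mem _
        (Submodule.smul_mem _ _ (Finsupp.single_mem_supported V _ hxU)) htU
    have hzx : i z x = r := by
      have := DFunLike.congr_fun hzt x
      simpa [(Finsupp.mem_supported' _ _).1 ht x hxS] using this
    have hz := hW z hzU
    rw [Finsupp.supported_union] at hz
    obtain ⟨z₁, hz₁, z₂, hz₂, rfl⟩ := Submodule.mem_sup.1 hz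
    have hi₁ := map_mem_supported_of_mem hz₁
    refine ⟨z₂, ⟨hz₂, (hPmem z₂ hz₂).2 ?_⟩, ?_⟩
    · have : i z₂ = i (z₁ + z₂) - i z₁ := by rw [map_add]; abel
      rw [this]
      exact Submodule.sub_mem _ hzU (Finsupp.supported_mono Set.subset_union_left hi₁)
    · rw [← hzx, map_add, Finsupp.add_apply,
        (Finsupp.mem_supported' _ _).1 hi₁ x fun h => hxS (Or.inl h), zero_add]
  · rintro ⟨z, ⟨hzW, hz⟩, rfl⟩
    have hzU := (hPmem z hzW).1 hz
    refine Submodule.mem_sup.2 ⟨i z, ⟨z, rfl⟩, i z x • Finsupp.single x 1 - i z, ?_, by abel⟩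
    rw [Finsupp.mem_supported'] at hzU ⊢
    intro a ha
    by_cases hax : a = x
    · subst hax
      simp
    · have := hzU a (by simpa [U, hax] using ha)
      simp [this, Ne.symm hax]

theorem Saturated.exists_extend_countable {E : Type*} [AddCommGroup E] [Module V E]
    (hE : Divisible V E) {S : Set X} (hS : Saturated i S) (e : ℕ → X) (f : (X →₀ V) →ₗ.[V] E)
    (hf : f.domain = LinearMap.range i ⊔ Finsupp.supported V V S) :
    ∃ g : (X →₀ V) →ₗ.[V] E, f ≤ g ∧
      g.domain = LinearMap.range i ⊔ Finsupp.supported V V (S ∪ Set.range e) := by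
  classical
  let B : ℕ → Finset X := fun n => (Finset.range n).image e
  let D : ℕ → Submodule V (X →₀ V) := fun n =>
    LinearMap.range i ⊔ Finsupp.supported V V (S ∪ B n)
  have hB : ∀ n, (B (n + 1) : Set X) = (B n : Set X) ∪ {e n} := fun n => by
    simp [B, Finset.range_add_one, Finset.image_insert]
  have step : ∀ n (h : (X →₀ V) →ₗ.[V] E), h.domain = D n →
      ∃ g, h ≤ g ∧ g.domain = D (n + 1) := by
    intro n h hh
    by_cases hx : e n ∈ S ∪ (B n : Set X)
    · refine ⟨h, le_rfl, hh.trans ?_⟩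
      simp only [D, hB]
      rw [← Set.union_assoc, Set.union_eq_self_of_subset_right (t := {e n})
        (Set.singleton_subset_iff.2 hx)]
    · obtain ⟨g, hg, hgd⟩ := h.exists_extend_span_singleton hE (Finsupp.single (e n) 1)
        (hh ▸ hS.isPrincipal_comap (B n) (e n) hx)
      refine ⟨g, hg, ?_⟩
      simp only [hgd, hh, D, hB]
      rw [← Set.union_assoc, Finsupp.supported_union _ {e n}, sup_assoc,
        Finsupp.supported_eq_span_single V {e n}, Set.image_singleton]
  choose! next hle hdom using step
  let g : ℕ → (X →₀ V) →ₗ.[V] E := fun n => Nat.rec f (fun n h => next n h) n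
  have hg : ∀ n, (g n).domain = D n := by
    intro n
    induction n with
    | zero => simpa [g, D, B] using hf
    | succ n ih => exact hdom n (g n) ih
  have hmono : Monotone g := monotone_nat_of_le_succ fun n => hle n (g n) (hg n)
  have hdir : DirectedOn (· ≤ ·) (Set.range g) := by
    rw [directedOn_range]
    exact hmono.directed_le
  refine ⟨LinearPMap.sSup _ hdir, LinearPMap.le_sSup hdir ⟨0, rfl⟩, ?_⟩
  rw [LinearPMap.domain_sSup, ← Set.range_comp, sSup_range]
  have hU : S ∪ Set.range e = ⋃ n, (S ∪ (B n : Set X)) := by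
    rw [← Set.union_iUnion]
    congr 1
    ext a
    simp only [B, Set.mem_range, Set.mem_iUnion, Finset.coe_image, Set.mem_image,
      Finset.coe_range, Set.mem_Iio]
    exact ⟨fun ⟨n, hn⟩ => ⟨n + 1, n, n.lt_succ_self, hn⟩, fun ⟨_, n, _, hn⟩ => ⟨n, hn⟩⟩
  rw [hU, Finsupp.supported_iUnion, sup_iSup]
  exact iSup_congr hg

/-- Linear maps into a divisible module over a valuation domain extend along injections of free
modules. -/
theorem exists_comp_eq_of_divisible_finsupp {E : Type*} [AddCommGroup E] [Module V E]
    (hE : Divisible V E) (hi : Function.Injective i) (φ : (Y →₀ V) →ₗ[V] E) :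
    ∃ ψ : (X →₀ V) →ₗ[V] E, ψ ∘ₗ i = φ := by
  classical
  let f₀ : (X →₀ V) →ₗ.[V] E :=
    ⟨LinearMap.range i, φ ∘ₗ (LinearEquiv.ofInjective i hi).symm.toLinearMap⟩
  let Z : Set (Set X × ((X →₀ V) →ₗ.[V] E)) :=
    {p | Saturated i p.1 ∧ p.2.domain = LinearMap.range i ⊔ Finsupp.supported V V p.1}
  have h₀ : (∅, f₀) ∈ Z := ⟨saturated_empty hi, by simp [f₀]⟩
  have hchain : ∀ c ⊆ Z, IsChain (· ≤ ·) c → ∀ p ∈ c, ∃ q ∈ Z, ∀ z ∈ c, z ≤ q := by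
    intro c hcZ hc p hp
    have hdir : DirectedOn (· ≤ ·) (Prod.snd '' c) :=
      directedOn_image.2 (hc.directedOn.mono fun _ _ h => h.2)
    have hne : c.Nonempty := ⟨p, hp⟩
    refine ⟨(⋃ q ∈ c, q.1, LinearPMap.sSup _ hdir), ⟨?_, ?_⟩, fun q hq =>
      ⟨Set.subset_biUnion_of_mem (u := fun q : Set X × _ => q.1) hq,
        LinearPMap.le_sSup hdir ⟨q, hq, rfl⟩⟩⟩
    · exact Saturated.biUnion hne (hc.directedOn.mono fun _ _ h => h.1) fun q hq => (hcZ hq).1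
    · dsimp only
      rw [LinearPMap.domain_sSup, Set.image_image, sSup_image, Set.biUnion_eq_iUnion,
        Finsupp.supported_iUnion, iSup_subtype']
      have : Nonempty c := hne.to_subtype
      rw [sup_iSup]
      exact iSup_congr fun q => (hcZ q.2).2
  obtain ⟨⟨S, f⟩, hle, hmax⟩ := zorn_le_nonempty₀ Z hchain _ h₀
  have hS : S = Set.univ := by
    refine Set.eq_univ_of_forall fun x => ?_
    obtain ⟨e, hxe, hsat⟩ := hmax.prop.1.exists_countable x
    obtain ⟨g, hfg, hg⟩ := hmax.prop.1.exists_extend_countable hE e f hmax.prop.2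
    exact (hmax.le_of_ge (y := (S ∪ Set.range e, g)) ⟨hsat, hg⟩
      ⟨Set.subset_union_left, hfg⟩).1 (Or.inr hxe)
  have hf : f.domain = ⊤ := by
    rw [hmax.prop.2]
    simp [hS, Finsupp.supported_univ]
  refine ⟨f.toFun ∘ₗ (LinearEquiv.ofTop _ hf).symm.toLinearMap, LinearMap.ext fun z => ?_⟩
  have h1 := hle.2.2 (x := ⟨i z, z, rfl⟩) (y := ⟨i z, hf ▸ Submodule.mem_top⟩) rfl
  refine h1.symm.trans ?_
  change φ ((LinearEquiv.ofInjective i hi).symm ⟨i z, z, rfl⟩) = φ z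
  congr 1
  exact (LinearEquiv.ofInjective i hi).symm_apply_apply z

end Saturated

section Projective

variable {V : Type*} [CommRing V]

/-- The Eilenberg swindle: a projective module becomes free after adding a free module. -/
theorem Module.Projective.exists_free_prod (P : Type*) [AddCommGroup P] [Module V P]
    [Module.Projective V P] :
    Module.Free V (P × (ℕ →₀ (P →₀ V))) := by
  obtain ⟨s, hs⟩ := (Module.projective_def' (R := V) (P := P)).1 inferInstance
  let π : (P →₀ V) →ₗ[V] P := Finsupp.linearCombination V id
  have hπ : ∀ p, π (s p) = p := fun p => LinearMap.congr_fun hs p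
  let a : (P →₀ V) →ₗ[V] (P →₀ V) := s ∘ₗ π
  let b : (P →₀ V) →ₗ[V] (P →₀ V) := LinearMap.id - a
  let fwd : (P × (ℕ →₀ (P →₀ V))) →ₗ[V] ℕ →₀ (P →₀ V) :=
    (Finsupp.lsingle 0 ∘ₗ s).coprod
      (Finsupp.mapRange.linearMap b +
        Finsupp.lmapDomain _ V Nat.succ ∘ₗ Finsupp.mapRange.linearMap a)
  let bwd : (ℕ →₀ (P →₀ V)) →ₗ[V] P × (ℕ →₀ (P →₀ V)) :=
    (π ∘ₗ Finsupp.lapply 0).prod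
      (Finsupp.mapRange.linearMap b +
        Finsupp.mapRange.linearMap a ∘ₗ Finsupp.lcomapDomain Nat.succ Nat.succ_injective)
  have hfwd0 : ∀ p g, fwd (p, g) 0 = s p + b (g 0) := fun p g => by
    simp [fwd, Finsupp.mapDomain_of_notMem_range]
  have hfwd1 : ∀ p g n, fwd (p, g) (n + 1) = b (g (n + 1)) + a (g n) := fun p g n => by
    simp [fwd, Finsupp.mapDomain_apply Nat.succ_injective]
  have hbwd1 : ∀ h, (bwd h).1 = π (h 0) := fun h => rfl
  have hbwd2 : ∀ h n, (bwd h).2 n = b (h n) + a (h (n + 1)) := fun h n => rfl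
  have e : (P × (ℕ →₀ (P →₀ V))) ≃ₗ[V] ℕ →₀ (P →₀ V) := by
    refine LinearEquiv.ofLinearMap fwd bwd ?_ ?_
    · refine LinearMap.ext fun h => Finsupp.ext fun n => ?_
      cases n with
      | zero =>
        rw [LinearMap.comp_apply, ← Prod.mk.eta (p := bwd h), hfwd0, hbwd1, hbwd2]
        simp [a, b, hπ]
      | succ n =>
        rw [LinearMap.comp_apply, ← Prod.mk.eta (p := bwd h), hfwd1, hbwd2, hbwd2]
        simp [a, b, hπ]
    · refine LinearMap.ext fun ⟨p, g⟩ => Prod.ext ?_ (Finsupp.ext fun n => ?_)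
      · rw [LinearMap.comp_apply, hbwd1, hfwd0]
        simp [a, b, hπ]
      · rw [LinearMap.comp_apply, hbwd2, hfwd1]
        cases n with
        | zero =>
          rw [hfwd0]
          simp [a, b, hπ]
        | succ n =>
          rw [hfwd1]
          simp [a, b, hπ]
  exact Module.Free.of_equiv e.symm

variable [IsDomain V] [ValuationRing V] {E : Type*} [AddCommGroup E] [Module V E]

theorem exists_comp_eq_of_divisible_free (hE : Divisible V E) {A B : Type*}
    [AddCommGroup A] [Module V A] [AddCommGroup B] [Module V B] [Module.Free V A] [Module.Free V B]
    {i : A →ₗ[V] B} (hi : Function.Injective i) (φ : A →ₗ[V] E) :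
    ∃ ψ : B →ₗ[V] E, ψ ∘ₗ i = φ := by
  let a := (Module.Free.chooseBasis V A).repr
  let b := (Module.Free.chooseBasis V B).repr
  obtain ⟨ψ, hψ⟩ := exists_comp_eq_of_divisible_finsupp
    (i := b.toLinearMap ∘ₗ i ∘ₗ a.symm.toLinearMap) hE
    (b.injective.comp (hi.comp a.symm.injective)) (φ ∘ₗ a.symm.toLinearMap)
  refine ⟨ψ ∘ₗ b.toLinearMap, LinearMap.ext fun z => ?_⟩
  simpa using LinearMap.congr_fun hψ (a z)

theorem exists_comp_eq_of_divisible_projective (hE : Divisible V E) {K P : Type*}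
    [AddCommGroup K] [Module V K] [AddCommGroup P] [Module V P] [Module.Projective V K]
    [Module.Projective V P] {i : K →ₗ[V] P} (hi : Function.Injective i) (φ : K →ₗ[V] E) :
    ∃ ψ : P →ₗ[V] E, ψ ∘ₗ i = φ := by
  have hK : Module.Free V (K × (ℕ →₀ (K →₀ V))) := Module.Projective.exists_free_prod K
  have hP : Module.Free V (P × (ℕ →₀ (P →₀ V))) := Module.Projective.exists_free_prod P
  let j : ((K × (ℕ →₀ (K →₀ V))) × (ℕ →₀ (P →₀ V))) →ₗ[V]
      (P × (ℕ →₀ (P →₀ V))) × (ℕ →₀ (K →₀ V)) :=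
    ((i ∘ₗ LinearMap.fst _ _ _ ∘ₗ LinearMap.fst _ _ _).prod (LinearMap.snd _ _ _)).prod
      (LinearMap.snd _ _ _ ∘ₗ LinearMap.fst _ _ _)
  have hj : Function.Injective j := by
    rintro ⟨⟨k, x⟩, y⟩ ⟨⟨k', x'⟩, y'⟩ h
    have h' : ((i k, y), x) = ((i k', y'), x') := h
    simp only [Prod.mk.injEq] at h'
    rw [hi h'.1.1, h'.1.2, h'.2]
  let φ' : ((K × (ℕ →₀ (K →₀ V))) × (ℕ →₀ (P →₀ V))) →ₗ[V] E :=
    φ ∘ₗ LinearMap.fst _ _ _ ∘ₗ LinearMap.fst _ _ _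
  obtain ⟨ψ, hψ⟩ := exists_comp_eq_of_divisible_free
    (A := (K × (ℕ →₀ (K →₀ V))) × (ℕ →₀ (P →₀ V))) (B := (P × (ℕ →₀ (P →₀ V))) × (ℕ →₀ (K →₀ V)))
    hE hj φ'
  refine ⟨ψ ∘ₗ LinearMap.inl _ _ _ ∘ₗ LinearMap.inl _ _ _, LinearMap.ext fun k => ?_⟩
  simpa [j, φ'] using! LinearMap.congr_fun hψ ((k, 0), 0)

/-- Extensions of a module of projective dimension at most one by a divisible module over a
valuation domain split. -/
theorem PdLeOne.exists_retraction {C N : Type*} [AddCommGroup C] [Module V C] [AddCommGroup N]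
    [Module V N] (hC : PdLeOne V C) (hE : Divisible V E) (f : E →ₗ[V] N) (g : N →ₗ[V] C)
    (hf : Function.Injective f) (hg : Function.Surjective g)
    (hfg : LinearMap.range f = LinearMap.ker g) : ∃ h : N →ₗ[V] E, h ∘ₗ f = LinearMap.id := by
  obtain ⟨P, _, _, π, hP, hπ, hK⟩ := hC
  obtain ⟨l, hl⟩ := Module.projective_lifting_property g π hg
  let ef := LinearEquiv.ofInjective f hf
  have hfe : ∀ x : LinearMap.range f, f (ef.symm x) = x := fun x =>
    congrArg Subtype.val (ef.apply_symm_apply x)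
  have hlK : ∀ k : LinearMap.ker π, l k ∈ LinearMap.range f := fun k => by
    rw [hfg, LinearMap.mem_ker]
    exact (LinearMap.congr_fun hl k).trans k.2
  obtain ⟨ψ, hψ⟩ := exists_comp_eq_of_divisible_projective hE
    (LinearMap.ker π).injective_subtype
    (ef.symm.toLinearMap ∘ₗ (l.domRestrict (LinearMap.ker π)).codRestrict _ hlK)
  let m : P →ₗ[V] N := l - f ∘ₗ ψ
  have hm : LinearMap.ker π ≤ LinearMap.ker m := fun k hk => by
    have h1 : ψ k = ef.symm ⟨l k, hlK ⟨k, hk⟩⟩ := LinearMap.congr_fun hψ ⟨k, hk⟩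
    rw [LinearMap.mem_ker]
    simp [m, h1, hfe]
  let σ : C →ₗ[V] N :=
    (LinearMap.ker π).liftQ m hm ∘ₗ (π.quotKerEquivOfSurjective hπ).symm.toLinearMap
  have hσ : ∀ p, σ (π p) = m p := fun p => by
    have : (π.quotKerEquivOfSurjective hπ).symm (π p) = (LinearMap.ker π).mkQ p :=
      (LinearEquiv.symm_apply_eq _).2 rfl
    simp [σ, this]
  have hgf : ∀ x, g (f x) = 0 := fun x => LinearMap.mem_ker.1 (hfg ▸ ⟨x, rfl⟩)
  have hgσ : ∀ c, g (σ c) = c := fun c => by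
    obtain ⟨p, rfl⟩ := hπ c
    rw [hσ]
    simp only [m, LinearMap.sub_apply, map_sub, LinearMap.comp_apply, hgf, sub_zero]
    exact LinearMap.congr_fun hl p
  refine ⟨ef.symm.toLinearMap ∘ₗ (LinearMap.id - σ ∘ₗ g).codRestrict (LinearMap.range f)
    fun n => ?_, LinearMap.ext fun x => hf ?_⟩
  · simp only [LinearMap.comp_apply, LinearEquiv.coe_coe, hfe]
    simp [hgf]
  · rw [hfg, LinearMap.mem_ker]
    simp [hgσ]

end Projective

theorem divisible_of_forall_retraction (V : Type u) [CommRing V] [IsDomain V]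
    (E : Type v) [AddCommGroup E] [Module V E]
    (h : ∀ (C : Type (max u v)) [AddCommGroup C] [Module V C], PdLeOne V C →
      ∀ (N : Type (max u v)) [AddCommGroup N] [Module V N]
        (f : E →ₗ[V] N) (g : N →ₗ[V] C),
        Function.Injective f → Function.Surjective g →
        LinearMap.range f = LinearMap.ker g →
        ∃ h : N →ₗ[V] E, h ∘ₗ f = LinearMap.id) : Divisible V E := by
  intro r hr d
  let K : Submodule V (E × V) := V ∙ (d, -r)
  let R : Submodule V (ULift.{v} V) := V ∙ (ULift.up r)
  let f : E →ₗ[V] (E × V) ⧸ K := K.mkQ ∘ₗ LinearMap.inl V E V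
  let g₀ : (E × V) →ₗ[V] ULift.{v} V ⧸ R :=
    R.mkQ ∘ₗ ULift.moduleEquiv.symm.toLinearMap ∘ₗ LinearMap.snd V E V
  have hg₀ : ∀ p, g₀ p = 0 ↔ ∃ c : V, c * r = p.2 := fun p => by
    simp [g₀, R, Submodule.mem_span_singleton, ULift.ext_iff]
  have hK : K ≤ LinearMap.ker g₀ := by
    refine (Submodule.span_singleton_le_iff_mem _ _).2 ?_
    exact (hg₀ _).2 ⟨-1, by simp⟩
  let g : ((E × V) ⧸ K) →ₗ[V] ULift.{v} V ⧸ R := K.liftQ g₀ hK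
  have hpd : PdLeOne V (ULift.{v} V ⧸ R) := by
    refine ⟨ULift.{v} V, inferInstance, inferInstance, R.mkQ, inferInstance, R.mkQ_surjective, ?_⟩
    rw [Submodule.ker_mkQ]
    have hr' : (ULift.up r : ULift.{v} V) ≠ 0 := fun h0 => hr (congrArg ULift.down h0)
    exact Module.Projective.of_equiv (LinearEquiv.toSpanNonzeroSingleton V _ _ hr')
  have hinj : Function.Injective f := by
    rw [injective_iff_map_eq_zero]
    intro x hx
    have hx' : ((x, 0) : E × V) ∈ K := (Submodule.Quotient.mk_eq_zero K).1 hx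
    obtain ⟨c, hc⟩ := Submodule.mem_span_singleton.1 hx'
    have hc0 : c = 0 := by simpa [hr] using congrArg Prod.snd hc
    simpa [hc0] using (congrArg Prod.fst hc).symm
  have hsurj : Function.Surjective g := by
    intro c
    obtain ⟨⟨w⟩, rfl⟩ := R.mkQ_surjective c
    exact ⟨K.mkQ (0, w), rfl⟩
  have hexact : LinearMap.range f = LinearMap.ker g := by
    refine le_antisymm ?_ fun n hn => ?_
    · rintro _ ⟨x, rfl⟩
      exact (hg₀ (x, 0)).2 ⟨0, zero_mul r⟩
    · obtain ⟨⟨x, w⟩, rfl⟩ := K.mkQ_surjective n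
      obtain ⟨c, hc⟩ := (hg₀ (x, w)).1 hn
      refine ⟨x + c • d, (Submodule.Quotient.eq K).2 ?_⟩
      refine Submodule.mem_span_singleton.2 ⟨c, ?_⟩
      simp only at hc
      simp [← hc]
  obtain ⟨t, ht⟩ := h _ hpd _ f g hinj hsurj hexact
  refine ⟨t (K.mkQ (0, 1)), ?_⟩
  have h1 : t (K.mkQ (d, 0)) = d := LinearMap.congr_fun ht d
  conv_rhs => rw [← h1]
  rw [← map_smul, ← map_smul]
  congr 1
  refine ((Submodule.Quotient.eq K).2 ?_).symm
  simp [K]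

/-- for a module E of p.d. ≤ 1 over a valuation domain,
Ext¹(C, E) = 0 for all modules C of p.d. ≤ 1 (i.e., every short exact sequence
0 → E → N → C → 0 with p.d. C ≤ 1 splits) iff E is divisible. -/
theorem statement16 (V : Type u) [CommRing V] [IsDomain V] [ValuationRing V]
    (E : Type v) [AddCommGroup E] [Module V E] (hE : PdLeOne V E) :
    (∀ (C : Type (max u v)) [AddCommGroup C] [Module V C], PdLeOne V C →
      ∀ (N : Type (max u v)) [AddCommGroup N] [Module V N]
        (f : E →ₗ[V] N) (g : N →ₗ[V] C),
        Function.Injective f → Function.Surjective g →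
        LinearMap.range f = LinearMap.ker g →
        ∃ h : N →ₗ[V] E, h ∘ₗ f = LinearMap.id) ↔
    Divisible V E := by
  exact ⟨divisible_of_forall_retraction V E, fun hD C _ _ hC N _ _ f g hf hg hfg =>
    hC.exists_retraction hD f g hf hg hfg⟩
end
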